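/- arXiv:1603.05639 — 2 statements merged into one kernel-verified Lean document; each statement's English description precedes it below -/
import Mathlib

section
/- There exist positive constants c and C such that for all sufficiently large n divisible by 4, the two-cycle chain with golden-ratio laziness satisfies c/n ≤ P^t(x,y) ≤ C/n for all states x,y and every integer t with n^{3/2}/10 ≤ t ≤ 10·n^{3/2}. -/
open Finset

/-- The state space of the two-cycle chain: a common vertex `o` (the `Sum.inl` state) together
with two cycles indexed by `Fin 2`; `Sum.inr (i, j)` is position `j+1 ∈ {1,…,n−1}` on cycle
`i` (cycle `1` of the paper is `i = 0`, the "left" cycle). -/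
abbrev TwoCycleState (n : ℕ) := Unit ⊕ (Fin 2 × Fin (n - 1))

/-- The golden-ratio laziness parameter `α = 2/(√5+1)`. -/
noncomputable def goldenAlpha : ℝ := 2 / (Real.sqrt 5 + 1)

/-- The holding probability: `α` at states of the left cycle whose position `j` satisfies
`n/4 ≤ j ≤ 3n/4`, and `1/2` everywhere else (including at `o`). -/
noncomputable def tcHold (n : ℕ) : TwoCycleState n → ℝ
  | Sum.inl _ => 1 / 2
  | Sum.inr (i, j) =>
      if i = 0 ∧ n / 4 ≤ (j : ℕ) + 1 ∧ (j : ℕ) + 1 ≤ 3 * n / 4 then goldenAlpha else 1 / 2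

/-- The conditional move distribution of the two-cycle chain: given that the chain moves, it
goes clockwise (position `+1`) with probability `2/3` and counter-clockwise (position `−1`)
with probability `1/3`; from `o` it additionally picks one of the two cycles uniformly. -/
noncomputable def tcStep (n : ℕ) : TwoCycleState n → TwoCycleState n → ℝ
  | Sum.inl _, Sum.inl _ => 0
  | Sum.inl _, Sum.inr (_, j) =>
      (if (j : ℕ) = 0 then 1 / 3 else 0) + (if (j : ℕ) + 2 = n then 1 / 6 else 0)
  | Sum.inr (_, j), Sum.inl _ =>
      (if (j : ℕ) + 2 = n then 2 / 3 else 0) + (if (j : ℕ) = 0 then 1 / 3 else 0)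
  | Sum.inr (i, j), Sum.inr (i', j') =>
      if i = i' then
        (if (j' : ℕ) = (j : ℕ) + 1 then 2 / 3 else 0) +
          (if (j' : ℕ) + 1 = (j : ℕ) then 1 / 3 else 0)
      else 0

/-- The transition matrix of the two-cycle chain with golden-ratio laziness: stay in place with
the holding probability, and otherwise move according to `tcStep`. -/
noncomputable def tcP (n : ℕ) : Matrix (TwoCycleState n) (TwoCycleState n) ℝ :=
  fun x y => (if x = y then tcHold n x else 0) + (1 - tcHold n x) * tcStep n x y

/-! ### Bounds for binomial probabilities -/

/-- The binomial probability `C(N, j) / 2 ^ N`. -/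
noncomputable def binProb (N j : ℕ) : ℝ := (N.choose j : ℝ) / 2 ^ N

lemma binProb_nonneg (N j : ℕ) : 0 ≤ binProb N j := by unfold binProb; positivity

lemma sum_binProb (N : ℕ) : ∑ j ∈ range (N + 1), binProb N j = 1 := by
  unfold binProb
  rw [← Finset.sum_div]
  have h := Nat.sum_range_choose N
  have h' : (∑ j ∈ range (N + 1), (N.choose j : ℝ)) = 2 ^ N := by exact_mod_cast h
  rw [h', div_self (by positivity)]

lemma binProb_le_two_mul_succ (N j : ℕ) : binProb N j ≤ 2 * binProb (N + 1) j := by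
  have h : (N.choose j : ℝ) ≤ ((N + 1).choose j : ℝ) := by
    exact_mod_cast Nat.choose_le_choose j (Nat.le_succ N)
  unfold binProb
  rw [pow_succ, div_le_iff₀ (by positivity)]
  field_simp
  exact h

lemma binProb_symm {N j : ℕ} (h : j ≤ N) : binProb N (N - j) = binProb N j := by
  unfold binProb
  rw [Nat.choose_symm h]

lemma centralBinom_div_recurrence (c : ℕ) :
    ((c + 1).centralBinom : ℝ) / 4 ^ (c + 1) =
      (c.centralBinom : ℝ) / 4 ^ c * ((2 * c + 1) / (2 * c + 2)) := by
  have h := Nat.succ_mul_centralBinom_succ c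
  have h' : ((c : ℝ) + 1) * ((c + 1).centralBinom : ℝ) = 2 * (2 * c + 1) * c.centralBinom := by
    exact_mod_cast h
  rw [pow_succ]
  field_simp
  linarith

lemma centralBinom_div_sq_mul_le (c : ℕ) :
    ((c.centralBinom : ℝ) / 4 ^ c) ^ 2 * (2 * c + 1) ≤ 1 := by
  induction c with
  | zero => simp
  | succ c ih =>
    rw [centralBinom_div_recurrence, mul_pow]
    refine le_trans ?_ ih
    rw [mul_assoc]
    refine mul_le_mul_of_nonneg_left ?_ (sq_nonneg _)
    push_cast
    rw [div_pow, div_mul_eq_mul_div, div_le_iff₀ (by positivity)]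
    have : (0 : ℝ) ≤ c := Nat.cast_nonneg c
    nlinarith

lemma le_centralBinom_div_sq_mul {c : ℕ} (hc : 1 ≤ c) :
    1 / 4 ≤ ((c.centralBinom : ℝ) / 4 ^ c) ^ 2 * c := by
  induction c, hc using Nat.le_induction with
  | base => norm_num [Nat.centralBinom, Nat.choose]
  | succ c hc ih =>
    rw [centralBinom_div_recurrence, mul_pow]
    refine le_trans ih ?_
    rw [mul_assoc]
    refine mul_le_mul_of_nonneg_left ?_ (sq_nonneg _)
    push_cast
    rw [div_pow, div_mul_eq_mul_div, le_div_iff₀ (by positivity)]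
    have : (0 : ℝ) ≤ c := Nat.cast_nonneg c
    nlinarith

lemma choose_add_succ_mul (c x : ℕ) (hx : x ≤ c) :
    ((2 * c).choose (c + (x + 1)) : ℝ) * (c + x + 1) = (2 * c).choose (c + x) * (c - x) := by
  have h := Nat.choose_succ_right_eq (2 * c) (c + x)
  have e : 2 * c - (c + x) = c - x := by omega
  rw [e] at h
  have h' := congrArg (Nat.cast : ℕ → ℝ) h
  push_cast [Nat.cast_sub hx] at h'
  rw [← add_assoc]
  linarith

lemma choose_mul_le_centralBinom (c x : ℕ) :
    ((2 * c).choose (c + x) : ℝ) * (2 * c + x ^ 2) ≤ c.centralBinom * (2 * c) := by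
  induction x with
  | zero => simp [Nat.centralBinom]
  | succ x ih =>
    rcases lt_or_ge c x.succ with h | h
    · rw [Nat.choose_eq_zero_of_lt (by omega)]
      simp only [Nat.cast_zero, zero_mul]
      positivity
    · refine le_trans ?_ ih
      have hx : x ≤ c := by omega
      have e := choose_add_succ_mul c x hx
      have hxc : (x : ℝ) ≤ c := by exact_mod_cast hx
      have hx0 : (0 : ℝ) ≤ x := Nat.cast_nonneg x
      set a : ℝ := ((2 * c).choose (c + (x + 1)) : ℝ)
      set b : ℝ := ((2 * c).choose (c + x) : ℝ)
      have hb : 0 ≤ b := Nat.cast_nonneg _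
      have hp : (0 : ℝ) < c + x + 1 := by positivity
      refine le_of_mul_le_mul_right ?_ hp
      push_cast
      calc a * (2 * c + (x + 1) ^ 2) * (c + x + 1)
          = (a * (c + x + 1)) * (2 * c + (x + 1) ^ 2) := by ring
        _ = b * ((c - x) * (2 * c + (x + 1) ^ 2)) := by rw [e]; ring
        _ ≤ b * ((2 * c + x ^ 2) * (c + x + 1)) := by
            refine mul_le_mul_of_nonneg_left ?_ hb
            have : (0 : ℝ) ≤ (2 * x + 1) * (c + x ^ 2 + x) := by positivity
            nlinarith
        _ = b * (2 * c + x ^ 2) * (c + x + 1) := by ring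

lemma binProb_two_mul_le_aux {c : ℕ} (hc : 1 ≤ c) (x : ℕ) :
    binProb (2 * c) (c + x) ≤ 4 * √(2 * c : ℝ) / (2 * c + (2 * x) ^ 2) := by
  have h1 := choose_mul_le_centralBinom c x
  have h2 := centralBinom_div_sq_mul_le c
  set a : ℝ := (c.centralBinom : ℝ) / 4 ^ c with ha
  have hc' : (1 : ℝ) ≤ c := by exact_mod_cast hc
  have hs : √(2 * c : ℝ) ^ 2 = 2 * c := Real.sq_sqrt (by positivity)
  have hs0 : 0 < √(2 * c : ℝ) := Real.sqrt_pos.mpr (by positivity)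
  have ha0 : 0 ≤ a := by positivity
  have h3 : a * √(2 * c : ℝ) ≤ 1 := by
    have : (a * √(2 * c : ℝ)) ^ 2 ≤ 1 := by rw [mul_pow, hs]; nlinarith [sq_nonneg a]
    nlinarith [mul_nonneg ha0 hs0.le]
  have h4 : binProb (2 * c) (c + x) * (2 * c + x ^ 2) ≤ a * (2 * c) := by
    unfold binProb
    rw [ha, pow_mul, show (2 : ℝ) ^ 2 = 4 by norm_num, div_mul_eq_mul_div, div_mul_eq_mul_div]
    gcongr
  have hb := binProb_nonneg (2 * c) (c + x)
  rw [le_div_iff₀ (by positivity)]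
  have h5 : a * (2 * c) ≤ √(2 * c : ℝ) := by
    nth_rewrite 1 [← hs]
    nlinarith
  nlinarith [mul_nonneg hb (by positivity : (0 : ℝ) ≤ c)]

lemma binProb_two_mul_le {c : ℕ} (hc : 1 ≤ c) (j : ℕ) :
    binProb (2 * c) j ≤ 4 * √(2 * c : ℝ) / (2 * c + (2 * j - 2 * c) ^ 2) := by
  rcases le_total c j with h | h
  · obtain ⟨x, rfl⟩ := Nat.exists_eq_add_of_le h
    have := binProb_two_mul_le_aux hc x
    push_cast
    rwa [show (2 * ((c : ℝ) + x) - 2 * c) = 2 * x by ring]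
  · obtain ⟨x, rfl⟩ := Nat.exists_eq_add_of_le h
    have := binProb_two_mul_le_aux hc x
    rw [← binProb_symm (by omega), show 2 * (j + x) - (j + x + x) = j by omega] at this
    refine this.trans_eq ?_
    push_cast
    ring

/-- Upper bound for binomial probabilities with quadratic decay away from the mean. -/
lemma binProb_le {N : ℕ} (hN : 1 ≤ N) (j : ℕ) :
    binProb N j ≤ 48 * √(N : ℝ) / (N + (2 * j - N) ^ 2) := by
  have hN' : (1 : ℝ) ≤ N := by exact_mod_cast hN
  rcases Nat.even_or_odd' N with ⟨c, rfl | rfl⟩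
  · have := binProb_two_mul_le (c := c) (by omega) j
    refine this.trans ?_
    push_cast
    gcongr
    norm_num
  · have h1 := binProb_le_two_mul_succ (2 * c + 1) j
    have h2 := binProb_two_mul_le (c := c + 1) (by omega) j
    rw [show 2 * (c + 1) = 2 * c + 1 + 1 by ring] at h2
    have hc : (0 : ℝ) ≤ c := Nat.cast_nonneg c
    refine h1.trans ((mul_le_mul_of_nonneg_left h2 two_pos.le).trans ?_)
    push_cast
    have hs : √(2 * ((c : ℝ) + 1)) ≤ 2 * √(2 * c + 1 : ℝ) := by
      rw [Real.sqrt_le_left (by positivity), mul_pow, Real.sq_sqrt (by positivity)]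
      linarith
    rw [← mul_div_assoc, div_le_div_iff₀ (by positivity) (by positivity)]
    have h3 : (2 * (c : ℝ) + 1 + (2 * j - (2 * c + 1)) ^ 2) ≤
        3 * (2 * (c + 1) + (2 * j - 2 * (c + 1)) ^ 2) := by
      nlinarith [sq_nonneg ((2 * (j : ℝ) - 2 * (c + 1)) * 2 - 1)]
    calc _ ≤ 2 * (4 * (2 * √(2 * c + 1 : ℝ))) *
          (3 * (2 * (c + 1) + (2 * j - 2 * (c + 1)) ^ 2)) := by
          gcongr
      _ = _ := by ring

lemma exp_neg_two_mul_le {y : ℝ} (h0 : 0 ≤ y) (h1 : y ≤ 1 / 2) : Real.exp (-(2 * y)) ≤ 1 - y := by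
  have h := Real.add_one_le_exp (2 * y)
  rw [Real.exp_neg, inv_le_iff_one_le_mul₀ (Real.exp_pos _)]
  nlinarith

lemma centralBinom_mul_pow_le (c x X : ℕ) (hc : 1 ≤ c) (hxX : x ≤ X) (hX : 4 * X ≤ c) :
    (c.centralBinom : ℝ) * (1 - 2 * X / c) ^ x ≤ (2 * c).choose (c + x) := by
  induction x with
  | zero => simp [Nat.centralBinom]
  | succ x ih =>
    have ih := ih (by omega)
    have e := choose_add_succ_mul c x (by omega)
    have hc' : (1 : ℝ) ≤ c := by exact_mod_cast hc
    have hX' : (4 * X : ℝ) ≤ c := by exact_mod_cast hX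
    have hx' : (x + 1 : ℝ) ≤ X := by exact_mod_cast hxX
    have hx0 : (0 : ℝ) ≤ x := Nat.cast_nonneg x
    have hp : (0 : ℝ) < c + x + 1 := by positivity
    have hf : 0 ≤ 1 - 2 * (X : ℝ) / c := by
      rw [sub_nonneg, div_le_one (by linarith)]; linarith
    rw [pow_succ, ← mul_assoc]
    refine (mul_le_mul_of_nonneg_right ih hf).trans ?_
    refine le_of_mul_le_mul_right ?_ hp
    rw [e, mul_assoc]
    refine mul_le_mul_of_nonneg_left ?_ (Nat.cast_nonneg _)
    have : (1 - 2 * (X : ℝ) / c) * c = c - 2 * X := by field_simp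
    nlinarith [mul_nonneg hf hx0]

lemma le_binProb_two_mul {c x : ℕ} {K : ℝ} (hc : 1 ≤ c) (hx : 4 * x ≤ c)
    (hK : (x : ℝ) ^ 2 ≤ K * c) :
    Real.exp (-(4 * K)) / 2 / √(c : ℝ) ≤ binProb (2 * c) (c + x) := by
  have h1 := centralBinom_mul_pow_le c x x hc le_rfl hx
  have h2 := le_centralBinom_div_sq_mul hc
  have hc' : (1 : ℝ) ≤ c := by exact_mod_cast hc
  have hx' : (4 * x : ℝ) ≤ c := by exact_mod_cast hx
  set a : ℝ := (c.centralBinom : ℝ) / 4 ^ c with ha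
  have ha0 : 0 ≤ a := by positivity
  have hs : √(c : ℝ) ^ 2 = c := Real.sq_sqrt (by positivity)
  have hs0 : 0 < √(c : ℝ) := Real.sqrt_pos.mpr (by positivity)
  have h3 : 1 / 2 ≤ a * √(c : ℝ) := by
    have : (1 / 2) ^ 2 ≤ (a * √(c : ℝ)) ^ 2 := by rw [mul_pow, hs]; linarith
    exact le_of_sq_le_sq this (by positivity)
  have h4 : Real.exp (-(4 * K)) ≤ (1 - 2 * (x : ℝ) / c) ^ x := by
    have h5 := exp_neg_two_mul_le (y := 2 * x / c) (by positivity)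
      (by rw [div_le_iff₀ (by linarith)]; linarith)
    have h6 := pow_le_pow_left₀ (Real.exp_pos _).le h5 x
    refine le_trans ?_ h6
    rw [← Real.exp_nat_mul, Real.exp_le_exp]
    have : (x : ℝ) * (2 * (2 * x / c)) = 4 * (x ^ 2 / c) := by ring
    have h7 : (x : ℝ) ^ 2 / c ≤ K := by rwa [div_le_iff₀ (by linarith)]
    linarith
  unfold binProb
  rw [pow_mul, show (2 : ℝ) ^ 2 = 4 by norm_num]
  calc Real.exp (-(4 * K)) / 2 / √(c : ℝ) = Real.exp (-(4 * K)) * (1 / 2 / √(c : ℝ)) := by ring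
    _ ≤ (1 - 2 * (x : ℝ) / c) ^ x * a := by
        refine mul_le_mul h4 ?_ (by positivity) ((Real.exp_pos _).le.trans h4)
        rwa [div_le_iff₀ hs0]
    _ = c.centralBinom * (1 - 2 * (x : ℝ) / c) ^ x / 4 ^ c := by rw [ha]; ring
    _ ≤ _ := by gcongr

/-- Lower bound for binomial probabilities within the scale of the standard deviation. -/
lemma exists_le_binProb (K : ℝ) : ∃ δ : ℝ, 0 < δ ∧ ∃ N₀ : ℕ, ∀ N : ℕ, N₀ ≤ N → ∀ j : ℕ,
    |(2 * j - N : ℝ)| ≤ K * √(N : ℝ) → δ / √(N : ℝ) ≤ binProb N j := by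
  set M : ℝ := max K 1 with hM
  have hM1 : 1 ≤ M := le_max_right _ _
  refine ⟨Real.exp (-(4 * (3 * M ^ 2))) / 4, by positivity, ⌈100 * M ^ 2⌉₊ + 3, ?_⟩
  intro N hN j hj
  have hN1 : 100 * M ^ 2 + 3 ≤ (N : ℝ) := by
    have := Nat.le_ceil (100 * M ^ 2)
    have h2 : ((⌈100 * M ^ 2⌉₊ + 3 : ℕ) : ℝ) ≤ N := by exact_mod_cast hN
    push_cast at h2
    linarith
  have hNp : (0 : ℝ) < N := by nlinarith
  have hsN : √(N : ℝ) ^ 2 = N := Real.sq_sqrt hNp.le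
  have hsN0 : 0 < √(N : ℝ) := Real.sqrt_pos.mpr hNp
  have hj' : |(2 * j - N : ℝ)| ≤ M * √(N : ℝ) :=
    hj.trans (mul_le_mul_of_nonneg_right (le_max_left _ _) hsN0.le)
  have h10 : 10 * M ≤ √(N : ℝ) := by
    apply Real.le_sqrt_of_sq_le; nlinarith
  obtain ⟨c, hc⟩ : ∃ c, N = 2 * c ∨ N = 2 * c + 1 := Nat.even_or_odd' N
  have hcR : (2 * c : ℝ) ≤ N ∧ (N : ℝ) ≤ 2 * c + 1 := by
    constructor <;> rcases hc with h | h <;> rw [h] <;> push_cast <;> linarith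
  have hc1 : 1 ≤ c := by omega
  have hcc : (1 : ℝ) ≤ c := by exact_mod_cast hc1
  have key : Real.exp (-(4 * (3 * M ^ 2))) / 2 / √(c : ℝ) ≤ binProb (2 * c) j := by
    obtain ⟨x, hx⟩ : ∃ x : ℕ, j = c + x ∨ c = j + x := by
      rcases le_total c j with h | h
      · obtain ⟨x, rfl⟩ := Nat.exists_eq_add_of_le h; exact ⟨x, Or.inl rfl⟩
      · obtain ⟨x, rfl⟩ := Nat.exists_eq_add_of_le h; exact ⟨x, Or.inr rfl⟩
    have hx2 : (2 * x : ℝ) ≤ M * √(N : ℝ) + 1 := by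
      rw [abs_le] at hj'
      rcases hx with h | h
      · have : (j : ℝ) = c + x := by rw [h]; push_cast; ring
        linarith [hj'.1, hj'.2]
      · have : (c : ℝ) = j + x := by rw [h]; push_cast; ring
        linarith [hj'.1, hj'.2]
    have hMs : 1 ≤ M * √(N : ℝ) := by nlinarith
    have hx3 : (x : ℝ) ≤ M * √(N : ℝ) := by linarith
    have hx4 : (4 * x : ℝ) ≤ c := by nlinarith
    have hx4' : 4 * x ≤ c := by exact_mod_cast hx4
    have hx5 : (x : ℝ) ^ 2 ≤ 3 * M ^ 2 * c := by
      have : (x : ℝ) ^ 2 ≤ (M * √(N : ℝ)) ^ 2 := pow_le_pow_left₀ (Nat.cast_nonneg _) hx3 2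
      rw [mul_pow, hsN] at this
      nlinarith [sq_nonneg M]
    have := le_binProb_two_mul hc1 hx4' hx5
    rcases hx with h | h
    · rwa [h]
    · rw [← binProb_symm (by omega), show 2 * c - (c + x) = j by omega] at this
      exact this
  have hE := Real.exp_pos (-(4 * (3 * M ^ 2)))
  have hs : √(c : ℝ) ≤ √(N : ℝ) := Real.sqrt_le_sqrt (by linarith)
  have hs0 : 0 < √(c : ℝ) := Real.sqrt_pos.mpr (by linarith)
  have h2 : Real.exp (-(4 * (3 * M ^ 2))) / 2 / √(N : ℝ) ≤ binProb (2 * c) j :=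
    le_trans (by gcongr) key
  have h3 : binProb (2 * c) j ≤ 2 * binProb N j := by
    rcases hc with h | h
    · rw [h]; linarith [binProb_nonneg (2 * c) j]
    · rw [h]; exact binProb_le_two_mul_succ _ _
  have : Real.exp (-(4 * (3 * M ^ 2))) / 4 / √(N : ℝ) =
      (Real.exp (-(4 * (3 * M ^ 2))) / 2 / √(N : ℝ)) / 2 := by ring
  linarith

/-! ### The golden ratio and lattice points -/

lemma goldenAlpha_eq : goldenAlpha = (√5 - 1) / 2 := by
  have h : √5 ^ 2 = (5 : ℝ) := Real.sq_sqrt (by norm_num)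
  have h0 : 0 ≤ √(5 : ℝ) := Real.sqrt_nonneg 5
  unfold goldenAlpha
  rw [div_eq_div_iff (by positivity) (by norm_num)]
  nlinarith

lemma goldenAlpha_sq : goldenAlpha ^ 2 = 1 - goldenAlpha := by
  have h : √5 ^ 2 = (5 : ℝ) := Real.sq_sqrt (by norm_num)
  rw [goldenAlpha_eq]
  nlinarith

lemma goldenAlpha_gt : 0.618 < goldenAlpha := by
  have : (2.236 : ℝ) < √5 := Real.lt_sqrt_of_sq_lt (by norm_num)
  rw [goldenAlpha_eq]
  linarith

lemma goldenAlpha_lt : goldenAlpha < 0.6185 := by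
  have : √5 < (2.237 : ℝ) := by rw [Real.sqrt_lt' (by norm_num)]; norm_num
  rw [goldenAlpha_eq]
  linarith

lemma irrational_goldenAlpha : Irrational goldenAlpha := by
  have h : Irrational (√(5 : ℕ)) := Nat.Prime.irrational_sqrt (by norm_num)
  rw [goldenAlpha_eq]
  intro ⟨q, hq⟩
  exact h ⟨2 * q + 1, by push_cast; rw [hq]; ring⟩

lemma golden_combination_eq_zero {p q : ℤ} (h : (p : ℝ) + goldenAlpha * q = 0) :
    p = 0 ∧ q = 0 := by
  have hq : q = 0 := by
    by_contra hq
    apply irrational_goldenAlpha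
    have hq' : (q : ℝ) ≠ 0 := by exact_mod_cast hq
    refine ⟨-(p : ℚ) / q, ?_⟩
    push_cast
    rw [div_eq_iff hq']
    linarith
  subst hq
  simpa using h

lemma golden_norm_eq (p q : ℤ) :
    ((p : ℝ) + goldenAlpha * q) * (p - (1 + goldenAlpha) * q) = ((p ^ 2 - p * q - q ^ 2 : ℤ) : ℝ) := by
  push_cast
  linear_combination (-(q : ℝ) ^ 2) * goldenAlpha_sq

lemma one_le_abs_golden_norm {p q : ℤ} (h : ¬(p = 0 ∧ q = 0)) :
    1 ≤ |(p : ℝ) + goldenAlpha * q| * |(p - (1 + goldenAlpha) * q : ℝ)| := by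
  rw [← abs_mul, golden_norm_eq]
  have h1 : (p ^ 2 - p * q - q ^ 2 : ℤ) ≠ 0 := by
    intro h0
    have := golden_norm_eq p q
    rw [h0, Int.cast_zero, mul_eq_zero] at this
    rcases this with h2 | h2
    · exact h (golden_combination_eq_zero h2)
    · have h3 : ((p - q : ℤ) : ℝ) + goldenAlpha * ((-q : ℤ) : ℝ) = 0 := by
        push_cast; linarith
      have := golden_combination_eq_zero h3
      apply h
      omega
  have h2 := Int.one_le_abs h1
  exact_mod_cast h2

/-- The points `(3w(4p + αq), (2q - p)/w)` form a lattice separated uniformly in `w`. -/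
lemma lattice_separated {w : ℝ} (hw : 1 ≤ w) {p q : ℤ}
    (h1 : |3 * w * (4 * p + goldenAlpha * q)| < 1) (h2 : |((2 * q - p) / w : ℝ)| < 1) :
    p = 0 ∧ q = 0 := by
  by_contra hne
  have hne' : ¬((4 * p : ℤ) = 0 ∧ q = 0) := by omega
  have h := one_le_abs_golden_norm hne'
  push_cast at h
  have hw0 : 0 < w := by linarith
  rw [abs_div, abs_of_pos hw0, div_lt_one hw0] at h2
  rw [abs_mul, abs_of_pos (by positivity)] at h1
  have ha := goldenAlpha_gt
  have ha' := goldenAlpha_lt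
  set L : ℝ := 4 * p + goldenAlpha * q with hL
  have hLa : |L| < 1 := by nlinarith [abs_nonneg L]
  have hq : 8 * |(q : ℝ)| ≤ 4 * w + |L| := by
    have e : (8 + goldenAlpha) * (q : ℝ) = 4 * (2 * q - p) + L := by rw [hL]; ring
    have e2 : |(8 + goldenAlpha) * (q : ℝ)| ≤ 4 * |(2 * q - p : ℝ)| + |L| := by
      rw [e]
      refine (abs_add_le _ _).trans ?_
      rw [abs_mul]; norm_num
    rw [abs_mul, abs_of_pos (by linarith)] at e2
    nlinarith [abs_nonneg (q : ℝ)]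
  have hM : |(4 * p - (1 + goldenAlpha) * q : ℝ)| ≤ |L| + 2.3 * |(q : ℝ)| := by
    have e : (4 * p - (1 + goldenAlpha) * q : ℝ) = L + (-(1 + 2 * goldenAlpha)) * q := by
      rw [hL]; ring
    rw [e]
    refine (abs_add_le _ _).trans ?_
    rw [abs_mul, abs_neg, abs_of_pos (a := 1 + 2 * goldenAlpha) (by linarith)]
    nlinarith [abs_nonneg (q : ℝ)]
  have : |L| * |(4 * p - (1 + goldenAlpha) * q : ℝ)| ≤ |L| * (3 * w) := by
    refine mul_le_mul_of_nonneg_left ?_ (abs_nonneg _)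
    linarith
  linarith

/-- The Cauchy profile `1 / (1 + x ^ 2)`. -/
noncomputable def cauchyProfile (x : ℝ) : ℝ := 1 / (1 + x ^ 2)

lemma cauchyProfile_pos (x : ℝ) : 0 < cauchyProfile x := by unfold cauchyProfile; positivity

lemma cauchyProfile_le (x y : ℝ) :
    cauchyProfile x ≤ 2 * (1 + (x - y) ^ 2) * cauchyProfile y := by
  unfold cauchyProfile
  rw [mul_one_div, div_le_div_iff₀ (by positivity) (by positivity)]
  nlinarith [sq_nonneg (x - y), sq_nonneg (2 * x - y), sq_nonneg ((x - y) * x)]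

lemma cauchyProfile_le_of_abs_le {x y : ℝ} (h : |x - y| ≤ 1) :
    cauchyProfile x ≤ 4 * cauchyProfile y := by
  refine (cauchyProfile_le x y).trans ?_
  have : (x - y) ^ 2 ≤ 1 := by rwa [sq_le_one_iff_abs_le_one]
  nlinarith [cauchyProfile_pos y]

lemma summable_cauchyProfile_int : Summable fun a : ℤ => cauchyProfile a := by
  have h := (Real.summable_one_div_int_pow (p := 2)).mpr one_lt_two
  have h2 : Summable fun a : ℤ => if a = 0 then (1 : ℝ) else 0 :=
    summable_of_ne_finset_zero (s := {0}) (by simp)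
  refine Summable.of_nonneg_of_le (fun a => (cauchyProfile_pos _).le) ?_ (h.add h2)
  intro a
  by_cases ha : a = 0
  · simp [ha, cauchyProfile]
  · have : (0 : ℝ) < (a : ℝ) ^ 2 := by positivity
    simp only [ha, if_false, add_zero, cauchyProfile]
    gcongr
    linarith

lemma exists_lattice_sum_le : ∃ C : ℝ, 0 < C ∧ ∀ w : ℝ, 1 ≤ w → ∀ (a : ℝ) (S : Finset (ℤ × ℤ)),
    ∑ p ∈ S, cauchyProfile (3 * w * (4 * p.1 + goldenAlpha * p.2) - a) *
      cauchyProfile ((2 * p.2 - p.1) / w) ≤ C := by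
  have hsum : Summable fun z : ℤ × ℤ => cauchyProfile z.1 * cauchyProfile z.2 :=
    summable_cauchyProfile_int.mul_of_nonneg summable_cauchyProfile_int
      (fun a => (cauchyProfile_pos _).le) (fun a => (cauchyProfile_pos _).le)
  have hnn : ∀ z : ℤ × ℤ, 0 ≤ cauchyProfile z.1 * cauchyProfile z.2 := fun z =>
    mul_nonneg (cauchyProfile_pos _).le (cauchyProfile_pos _).le
  refine ⟨16 * (∑' z : ℤ × ℤ, cauchyProfile z.1 * cauchyProfile z.2) + 1,
    by have : 0 ≤ ∑' z : ℤ × ℤ, cauchyProfile z.1 * cauchyProfile z.2 := tsum_nonneg hnn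
       positivity, ?_⟩
  intro w hw a S
  set X : ℤ × ℤ → ℝ := fun p => 3 * w * (4 * p.1 + goldenAlpha * p.2) - a with hX
  set Y : ℤ × ℤ → ℝ := fun p => (2 * p.2 - p.1) / w with hY
  let φ : ℤ × ℤ → ℤ × ℤ := fun p => (⌊X p⌋, ⌊Y p⌋)
  have hinj : Function.Injective φ := by
    intro p q hpq
    simp only [φ, Prod.mk.injEq] at hpq
    have h1 := Int.abs_sub_lt_one_of_floor_eq_floor hpq.1
    have h2 := Int.abs_sub_lt_one_of_floor_eq_floor hpq.2
    have e1 : X p - X q = 3 * w * (4 * ((p.1 - q.1 : ℤ) : ℝ) + goldenAlpha * ((p.2 - q.2 : ℤ) : ℝ)) := by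
      simp only [hX]; push_cast; ring
    have e2 : Y p - Y q = (2 * ((p.2 - q.2 : ℤ) : ℝ) - ((p.1 - q.1 : ℤ) : ℝ)) / w := by
      simp only [hY]; push_cast; ring
    rw [e1] at h1
    rw [e2] at h2
    have := lattice_separated hw h1 h2
    ext <;> omega
  have hfl : ∀ x : ℝ, cauchyProfile x ≤ 4 * cauchyProfile ⌊x⌋ := by
    intro x
    apply cauchyProfile_le_of_abs_le
    rw [abs_of_nonneg (sub_nonneg.mpr (Int.floor_le x))]
    linarith [Int.lt_floor_add_one x]
  calc ∑ p ∈ S, cauchyProfile (X p) * cauchyProfile (Y p)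
      ≤ ∑ p ∈ S, 16 * (cauchyProfile (φ p).1 * cauchyProfile (φ p).2) := by
        refine Finset.sum_le_sum fun p _ => ?_
        have := mul_le_mul (hfl (X p)) (hfl (Y p)) (cauchyProfile_pos _).le
          (by have := cauchyProfile_pos ⌊X p⌋; positivity)
        refine this.trans_eq ?_
        simp only [φ]; ring
    _ = 16 * ∑ z ∈ S.map ⟨φ, hinj⟩, cauchyProfile z.1 * cauchyProfile z.2 := by
        rw [Finset.sum_map, Finset.mul_sum]; rfl
    _ ≤ 16 * (∑' z : ℤ × ℤ, cauchyProfile z.1 * cauchyProfile z.2) := by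
        gcongr
        exact hsum.sum_le_tsum _ (fun z _ => hnn z)
    _ ≤ _ := by linarith

/-- Inhomogeneous approximation by combinations of `4` and the golden ratio. -/
lemma exists_golden_approx {w : ℝ} (hw : 1 ≤ w) (T : ℝ) : ∃ r q : ℤ,
    |4 * r + goldenAlpha * q - T| ≤ 20 / w ∧ |(q : ℝ)| ≤ 8 * w := by
  have hw0 : 0 < w := by linarith
  have hNpos : 0 < ⌈w⌉₊ := Nat.ceil_pos.mpr hw0
  obtain ⟨x, hx1, hx2⟩ := Real.exists_rat_abs_sub_le_and_den_le goldenAlpha hNpos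
  set d : ℕ := x.den with hd
  set a : ℤ := x.num with ha
  have hd0 : 0 < d := x.den_pos
  have hdR : (1 : ℝ) ≤ d := by exact_mod_cast hd0
  have hxe : (x : ℝ) = a / d := by rw [Rat.cast_def]
  have hN1 : w ≤ (⌈w⌉₊ : ℝ) := Nat.le_ceil w
  have hN2 : (⌈w⌉₊ : ℝ) < w + 1 := Nat.ceil_lt_add_one hw0.le
  have hdw : (d : ℝ) ≤ 2 * w := by
    have : (d : ℝ) ≤ (⌈w⌉₊ : ℝ) := by exact_mod_cast hx2
    linarith
  have hα := goldenAlpha_gt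
  have hα' := goldenAlpha_lt
  have happ : |goldenAlpha - a / d| ≤ 1 / (w * d) := by
    rw [← hxe]
    refine hx1.trans ?_
    gcongr
    linarith
  have happ2 : |(a : ℝ) + goldenAlpha * ((-d : ℤ) : ℝ)| ≤ 1 / w := by
    have e : (a : ℝ) + goldenAlpha * ((-d : ℤ) : ℝ) = -(goldenAlpha - a / d) * d := by
      push_cast; field_simp; ring
    rw [e, abs_mul, abs_neg, Nat.abs_cast]
    refine (mul_le_mul_of_nonneg_right happ (Nat.cast_nonneg d)).trans_eq ?_
    field_simp
  have hdlow : w ≤ 4 * d := by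
    have h := one_le_abs_golden_norm (p := a) (q := -d) (by omega)
    have hM : |(a - (1 + goldenAlpha) * ((-d : ℤ) : ℝ) : ℝ)| ≤ 4 * d := by
      have e : (a - (1 + goldenAlpha) * ((-d : ℤ) : ℝ) : ℝ) =
          (a + goldenAlpha * ((-d : ℤ) : ℝ)) + (1 + 2 * goldenAlpha) * d := by push_cast; ring
      rw [e]
      refine (abs_add_le _ _).trans ?_
      rw [abs_of_nonneg (a := (1 + 2 * goldenAlpha) * (d : ℝ)) (by nlinarith)]
      have : 1 / w ≤ 1 := by rw [div_le_one hw0]; exact hw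
      nlinarith
    have h2 : 1 ≤ 1 / w * (4 * d) :=
      h.trans (mul_le_mul happ2 hM (abs_nonneg _) (by positivity))
    rw [one_div_mul_eq_div, le_div_iff₀ hw0] at h2
    linarith
  have hcop : IsCoprime a (d : ℤ) := by
    rw [Int.isCoprime_iff_gcd_eq_one]
    exact x.reduced
  obtain ⟨u, v, huv⟩ := hcop
  set z : ℤ := ⌊T * d / 4⌋ with hz
  set q : ℤ := (z * u) % d with hq
  have hdZ : (0 : ℤ) < d := by exact_mod_cast hd0
  have hq0 : 0 ≤ q := Int.emod_nonneg _ hdZ.ne'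
  have hqd : q < d := Int.emod_lt_of_pos _ hdZ
  obtain ⟨r, hr⟩ : ∃ r : ℤ, q * a + r * d = z := by
    refine ⟨z * v + a * ((z * u) / d), ?_⟩
    have := Int.emod_add_mul_ediv (z * u) d
    rw [← hq] at this
    have hqe : q = z * u - d * (z * u / d) := by linarith
    rw [hqe]
    linear_combination z * huv
  have hqR0 : (0 : ℝ) ≤ q := by exact_mod_cast hq0
  have hqRd : (q : ℝ) ≤ d := by exact_mod_cast hqd.le
  refine ⟨r, 4 * q, ?_, ?_⟩
  · have hrR : (q : ℝ) * a + r * d = z := by exact_mod_cast hr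
    have e : 4 * (r : ℝ) + goldenAlpha * ((4 * q : ℤ) : ℝ) - T =
        4 * ((z - T * d / 4) / d) + 4 * (q * (goldenAlpha - a / d)) := by
      rw [← hrR]; push_cast; field_simp; ring
    have h1 : |(z - T * d / 4 : ℝ)| ≤ 1 := by
      rw [abs_le]
      constructor <;> linarith [Int.floor_le (T * d / 4), Int.lt_floor_add_one (T * d / 4)]
    have h2 : |((z - T * d / 4) / d : ℝ)| ≤ 4 / w := by
      rw [abs_div, Nat.abs_cast, div_le_div_iff₀ (by linarith) hw0]
      nlinarith [abs_nonneg (z - T * d / 4 : ℝ)]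
    have h3 : |(q * (goldenAlpha - a / d) : ℝ)| ≤ 1 / w := by
      rw [abs_mul, abs_of_nonneg hqR0]
      calc (q : ℝ) * |goldenAlpha - a / d| ≤ d * (1 / (w * d)) := by gcongr
        _ = 1 / w := by field_simp
    rw [e]
    refine (abs_add_le _ _).trans ?_
    rw [abs_mul, abs_mul, abs_of_pos (by norm_num : (0 : ℝ) < 4)]
    have : (20 : ℝ) / w = 4 * (4 / w) + 4 * (1 / w) := by ring
    linarith
  · push_cast
    rw [abs_of_nonneg (by positivity)]
    linarith

/-- The state at position `j` of cycle `i`; positions outside `(0, n)` denote the vertex `o`. -/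
def tcPos (n : ℕ) (i : Fin 2) (j : ℕ) : TwoCycleState n :=
  if hj : 0 < j ∧ j < n then Sum.inr (i, ⟨j - 1, by omega⟩) else Sum.inl ()

/-- The two-cycle chain with a general holding function. -/
noncomputable def holdChain (n : ℕ) (h : TwoCycleState n → ℝ) :
    Matrix (TwoCycleState n) (TwoCycleState n) ℝ :=
  fun x y => (if x = y then h x else 0) + (1 - h x) * tcStep n x y

section

variable {n : ℕ}

lemma tcPos_of_mem {i : Fin 2} {j : ℕ} (h0 : 0 < j) (hj : j < n) :
    tcPos n i j = Sum.inr (i, ⟨j - 1, by omega⟩) := by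
  simp [tcPos, h0, hj]

@[simp] lemma tcPos_zero (i : Fin 2) : tcPos n i 0 = Sum.inl () := by simp [tcPos]

@[simp] lemma tcPos_self (i : Fin 2) : tcPos n i n = Sum.inl () := by simp [tcPos]

lemma tcPos_inr (i : Fin 2) (j : Fin (n - 1)) : tcPos n i (j + 1) = Sum.inr (i, j) := by
  have := j.2
  simp [tcPos, show (j : ℕ) + 1 < n by omega]

lemma exists_tcPos (x : TwoCycleState n) : ∃ i j, j ≤ n ∧ x = tcPos n i j := by
  rcases x with ⟨⟩ | ⟨i, j⟩
  · exact ⟨0, 0, Nat.zero_le _, by simp⟩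
  · exact ⟨i, j + 1, by have := j.2; omega, (tcPos_inr i j).symm⟩

lemma sum_fin_ite_eq {m : ℕ} (k : ℕ) (g : Fin m → ℝ) :
    ∑ j : Fin m, (if (j : ℕ) = k then g j else 0) = if hk : k < m then g ⟨k, hk⟩ else 0 := by
  split_ifs with hk
  · rw [Finset.sum_eq_single ⟨k, hk⟩]
    · simp
    · intro j _ hj
      rw [if_neg]
      intro h
      exact hj (Fin.ext h)
    · simp
  · refine sum_eq_zero fun j _ => if_neg ?_
    have := j.2; omega

lemma sum_tcStep_pos (F : TwoCycleState n → ℝ) (i : Fin 2) {j : ℕ} (h0 : 0 < j) (hj : j < n) :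
    ∑ y, tcStep n (tcPos n i j) y * F y =
      2 / 3 * F (tcPos n i (j + 1)) + 1 / 3 * F (tcPos n i (j - 1)) := by
  rw [tcPos_of_mem h0 hj]
  simp only [Fintype.sum_sum_type, Fintype.sum_prod_type, tcStep, Finset.univ_unique,
    sum_singleton]
  rw [Finset.sum_eq_single i (by
    intro i' _ hi'
    refine sum_eq_zero fun j' _ => ?_
    rw [if_neg (Ne.symm hi'), zero_mul]) (by simp)]
  simp only [if_true, add_mul, ite_mul, zero_mul, sum_add_distrib]
  rw [sum_fin_ite_eq (j - 1 + 1) (fun j' => 2 / 3 * F (Sum.inr (i, j')))]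
  have e : ∀ j' : Fin (n - 1), ((j' : ℕ) + 1 = j - 1) ↔ ((j' : ℕ) = j - 2 ∧ 2 ≤ j) := by
    intro j'; omega
  have e2 : ∑ j' : Fin (n - 1), (if (j' : ℕ) + 1 = j - 1 then 1 / 3 * F (Sum.inr (i, j')) else 0) =
      if 2 ≤ j then 1 / 3 * F (tcPos n i (j - 1)) else 0 := by
    split_ifs with h2
    · simp only [e, h2, and_true]
      rw [sum_fin_ite_eq (j - 2) (fun j' => 1 / 3 * F (Sum.inr (i, j'))), dif_pos (by omega),
        tcPos_of_mem (by omega) (by omega)]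
      rfl
    · exact sum_eq_zero fun j' _ => if_neg (by omega)
  rw [e2]
  by_cases h1 : j = 1
  · subst h1
    by_cases h3 : 1 + 1 < n
    · rw [dif_pos (by omega), if_neg (by omega), tcPos_of_mem (by omega) h3]
      simp
      rw [add_comm]
    · have : n = 2 := by omega
      subst this
      simp
  · rw [if_neg (show ¬ (j - 1 = 0) by omega), if_pos (show 2 ≤ j by omega)]
    by_cases h3 : j + 1 < n
    · rw [dif_pos (by omega), if_neg (by omega), tcPos_of_mem (j := j + 1) (by omega) h3]
      simp only [Nat.add_sub_cancel, Nat.sub_add_cancel h0]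
      ring
    · rw [dif_neg (by omega), if_pos (by omega)]
      have : j + 1 = n := by omega
      rw [this, tcPos_self]
      ring_nf

lemma sum_tcStep_inl (hn : 2 ≤ n) (F : TwoCycleState n → ℝ) (u : Unit) :
    ∑ y, tcStep n (Sum.inl u) y * F y =
      ∑ i, 1 / 2 * (2 / 3 * F (tcPos n i 1) + 1 / 3 * F (tcPos n i (n - 1))) := by
  simp only [Fintype.sum_sum_type, Fintype.sum_prod_type, tcStep, Finset.univ_unique,
    sum_singleton, zero_mul, zero_add]
  refine sum_congr rfl fun i _ => ?_
  simp only [add_mul, ite_mul, zero_mul, sum_add_distrib]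
  rw [sum_fin_ite_eq 0 (fun j' => 1 / 3 * F (Sum.inr (i, j')))]
  have e : ∀ j' : Fin (n - 1), ((j' : ℕ) + 2 = n) ↔ ((j' : ℕ) = n - 2) := by
    intro j'; omega
  simp only [e]
  rw [sum_fin_ite_eq (n - 2) (fun j' => 1 / 6 * F (Sum.inr (i, j'))), dif_pos (by omega),
    dif_pos (by omega), tcPos_of_mem (by omega) (by omega), tcPos_of_mem (by omega) (by omega)]
  simp only [Nat.sub_self, Nat.sub_sub]
  ring

lemma sum_mul_tcStep (G : TwoCycleState n → ℝ) (K : ℕ → ℝ) (i : Fin 2)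
    (hK0 : K 0 = G (Sum.inl ()) / 2) (hKn : K n = G (Sum.inl ()) / 2)
    (hK : ∀ j, 0 < j → j < n → K j = G (tcPos n i j)) {j : ℕ} (h0 : 0 < j) (hj : j < n) :
    ∑ x, G x * tcStep n x (tcPos n i j) = 2 / 3 * K (j - 1) + 1 / 3 * K (j + 1) := by
  rw [tcPos_of_mem h0 hj]
  simp only [Fintype.sum_sum_type, Fintype.sum_prod_type, tcStep, Finset.univ_unique,
    sum_singleton]
  rw [Finset.sum_eq_single i (by
    intro i' _ hi'
    refine sum_eq_zero fun j' _ => ?_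
    rw [if_neg hi', mul_zero]) (by simp)]
  simp only [if_true, mul_add, mul_ite, mul_zero, sum_add_distrib]
  have e : ∀ j' : Fin (n - 1), (j - 1 = (j' : ℕ) + 1) ↔ ((j' : ℕ) = j - 2 ∧ 2 ≤ j) := by
    intro j'; omega
  have e1 : ∑ j' : Fin (n - 1), (if j - 1 = (j' : ℕ) + 1 then G (Sum.inr (i, j')) * (2 / 3) else 0) =
      if 2 ≤ j then K (j - 1) * (2 / 3) else 0 := by
    split_ifs with h2
    · simp only [e, h2, and_true]
      rw [sum_fin_ite_eq (j - 2) (fun j' => G (Sum.inr (i, j')) * (2 / 3)), dif_pos (by omega),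
        hK _ (by omega) (by omega), tcPos_of_mem (by omega) (by omega)]
      rfl
    · exact sum_eq_zero fun j' _ => if_neg (by omega)
  have e' : ∀ j' : Fin (n - 1), (j - 1 + 1 = (j' : ℕ)) ↔ ((j' : ℕ) = j) := by
    intro j'; omega
  have e2 : ∑ j' : Fin (n - 1), (if j - 1 + 1 = (j' : ℕ) then G (Sum.inr (i, j')) * (1 / 3) else 0) =
      if j + 1 < n then K (j + 1) * (1 / 3) else 0 := by
    simp only [e']
    rw [sum_fin_ite_eq j (fun j' => G (Sum.inr (i, j')) * (1 / 3))]
    split_ifs with h2 h3 h3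
    · rw [hK _ (by omega) (by omega), tcPos_of_mem (by omega) (by omega)]
      rfl
    · omega
    · omega
    · rfl
  rw [e1, e2]
  rcases Nat.lt_or_ge 1 j with h1 | h1
  · rw [if_neg (show ¬ (j - 1 = 0) by omega), if_pos (show 2 ≤ j by omega)]
    split_ifs with h3 h4 h5
    · omega
    · have : j + 1 = n := by omega
      rw [this, hKn]; ring
    · ring
    · omega
  · have : j = 1 := by omega
    subst this
    simp only [Nat.sub_self, if_true, hK0]
    rw [if_neg (show ¬ 2 ≤ 1 by omega)]
    rcases Nat.lt_or_ge 2 n with h3 | h3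
    · rw [if_pos (show 1 + 1 < n by omega), if_neg (show ¬ 0 + 2 = n by omega)]
      ring
    · have : 1 + 1 = n := by omega
      rw [if_neg (show ¬ 1 + 1 < n by omega), if_pos (show 0 + 2 = n by omega), this, hKn]
      ring

end

section

variable {n : ℕ} {h : TwoCycleState n → ℝ}

lemma holdChain_sum (x : TwoCycleState n) (F : TwoCycleState n → ℝ) :
    ∑ y, holdChain n h x y * F y = h x * F x + (1 - h x) * ∑ y, tcStep n x y * F y := by
  simp only [holdChain, add_mul, ite_mul, zero_mul, sum_add_distrib, mul_assoc, ← mul_sum]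
  simp

lemma sum_holdChain (y : TwoCycleState n) (g : TwoCycleState n → ℝ) :
    ∑ x, g x * holdChain n h x y = h y * g y + ∑ x, (g x * (1 - h x)) * tcStep n x y := by
  simp only [holdChain, mul_add, mul_ite, mul_zero, sum_add_distrib, mul_assoc]
  simp [mul_comm]

lemma holdChain_pow_succ_pos (t : ℕ) (i : Fin 2) {j : ℕ} (h0 : 0 < j) (hj : j < n)
    (y : TwoCycleState n) :
    (holdChain n h ^ (t + 1)) (tcPos n i j) y =
      h (tcPos n i j) * (holdChain n h ^ t) (tcPos n i j) y + (1 - h (tcPos n i j)) *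
        (2 / 3 * (holdChain n h ^ t) (tcPos n i (j + 1)) y +
          1 / 3 * (holdChain n h ^ t) (tcPos n i (j - 1)) y) := by
  rw [pow_succ', Matrix.mul_apply, holdChain_sum _ (fun z => (holdChain n h ^ t) z y),
    sum_tcStep_pos (fun z => (holdChain n h ^ t) z y) i h0 hj]

lemma holdChain_pow_succ_inl (hn : 2 ≤ n) (t : ℕ) (u : Unit) (y : TwoCycleState n) :
    (holdChain n h ^ (t + 1)) (Sum.inl u) y =
      h (Sum.inl u) * (holdChain n h ^ t) (Sum.inl u) y + (1 - h (Sum.inl u)) *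
        ∑ i, 1 / 2 * (2 / 3 * (holdChain n h ^ t) (tcPos n i 1) y +
          1 / 3 * (holdChain n h ^ t) (tcPos n i (n - 1)) y) := by
  rw [pow_succ', Matrix.mul_apply, holdChain_sum _ (fun z => (holdChain n h ^ t) z y),
    sum_tcStep_inl hn (fun z => (holdChain n h ^ t) z y)]

lemma tcStep_nonneg (x y : TwoCycleState n) : 0 ≤ tcStep n x y := by
  rcases x with ⟨⟩ | ⟨i, j⟩ <;> rcases y with ⟨⟩ | ⟨i', j'⟩ <;> simp only [tcStep] <;>
    (try split_ifs) <;> norm_num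

lemma sum_tcStep (hn : 2 ≤ n) (x : TwoCycleState n) : ∑ y, tcStep n x y = 1 := by
  rcases x with ⟨⟩ | ⟨i, j⟩
  · have := sum_tcStep_inl hn (fun _ => 1) ()
    simp only [mul_one, Fin.sum_univ_two] at this
    rw [this]; norm_num
  · have := j.2
    have := sum_tcStep_pos (n := n) (fun _ => 1) i (j := j + 1) (by omega) (by omega)
    simp only [mul_one, tcPos_inr] at this
    rw [this]; norm_num

lemma holdChain_pow_nonneg (h0 : ∀ x, 0 ≤ h x) (h1 : ∀ x, h x ≤ 1) (t : ℕ)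
    (x y : TwoCycleState n) : 0 ≤ (holdChain n h ^ t) x y := by
  induction t generalizing x with
  | zero => rw [pow_zero, Matrix.one_apply]; split_ifs <;> norm_num
  | succ t ih =>
    rw [pow_succ', Matrix.mul_apply]
    refine sum_nonneg fun z _ => mul_nonneg ?_ (ih z)
    have := mul_nonneg (sub_nonneg.2 (h1 x)) (tcStep_nonneg x z)
    unfold holdChain
    split_ifs <;> linarith [h0 x]

lemma holdChain_pow_sum (hn : 2 ≤ n) (t : ℕ) (x : TwoCycleState n) :
    ∑ y, (holdChain n h ^ t) x y = 1 := by
  induction t generalizing x with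
  | zero => simp [Matrix.one_apply]
  | succ t ih =>
    simp only [pow_succ', Matrix.mul_apply]
    rw [sum_comm]
    simp only [← mul_sum, ih]
    rw [holdChain_sum x (fun _ => 1)]
    simp only [mul_one, sum_tcStep hn]
    ring

lemma holdChain_pow_le_one (h0 : ∀ x, 0 ≤ h x) (h1 : ∀ x, h x ≤ 1) (hn : 2 ≤ n) (t : ℕ)
    (x y : TwoCycleState n) : (holdChain n h ^ t) x y ≤ 1 := by
  rw [← holdChain_pow_sum (h := h) hn t x]
  exact single_le_sum (f := fun y => (holdChain n h ^ t) x y)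
    (fun z _ => holdChain_pow_nonneg h0 h1 t x z) (mem_univ y)

end

/-- A biased walk on `{0, …, n}` forgets its initial data geometrically fast and then takes values
between the extreme boundary values. -/
lemma arc_bounds {n : ℕ} {h : ℕ → ℝ} (h0 : ∀ x, 0 ≤ h x) (h1 : ∀ x, h x ≤ 2 / 3)
    {F : ℕ → ℕ → ℝ} {lo hi : ℝ} (hlo : 0 ≤ lo)
    (hF : ∀ t x, 0 < x → x < n →
      F (t + 1) x = h x * F t x + (1 - h x) * (2 / 3 * F t (x + 1) + 1 / 3 * F t (x - 1)))
    (hF0 : ∀ x, x ≤ n → 0 ≤ F 0 x) (hF1 : ∀ x, x ≤ n → F 0 x ≤ 1) {s : ℕ}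
    (hb : ∀ t, t ≤ s → (lo ≤ F t 0 ∧ F t 0 ≤ hi) ∧ (lo ≤ F t n ∧ F t n ≤ hi))
    {x : ℕ} (hx : x ≤ n) :
    lo * (1 - (2 - (x : ℝ) / n) * (1 - 1 / (18 * n)) ^ s) ≤ F s x ∧
      F s x ≤ hi + (2 - (x : ℝ) / n) * (1 - 1 / (18 * n)) ^ s := by
  rcases Nat.eq_zero_or_pos n with hn | hn
  · subst hn
    obtain rfl : x = 0 := by omega
    have := hb s le_rfl
    simp only [CharP.cast_eq_zero, div_zero, sub_zero, mul_zero, one_pow, mul_one]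
    constructor <;> linarith [this.1.1, this.1.2]
  have hn' : (1 : ℝ) ≤ n := by exact_mod_cast hn
  have hθ : (0 : ℝ) ≤ 1 - 1 / (18 * n) := by
    rw [sub_nonneg, div_le_one (by positivity)]; linarith
  have hhi : 0 ≤ hi := by have := hb 0 (Nat.zero_le _); linarith [this.1.1, this.1.2]
  induction s generalizing x with
  | zero =>
    have : (x : ℝ) / n ≤ 1 := by rw [div_le_one (by linarith)]; exact_mod_cast hx
    simp only [pow_zero, mul_one]
    constructor
    · have := hF0 x hx; nlinarith
    · linarith [hF1 x hx]
  | succ s ih =>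
    have hx1 : (x : ℝ) / n ≤ 1 := by rw [div_le_one (by linarith)]; exact_mod_cast hx
    by_cases hxi : 0 < x ∧ x < n
    · have ih' : ∀ {x : ℕ}, x ≤ n → _ := fun {x} hx => ih (fun t ht => hb t (by omega)) (x := x) hx
      obtain ⟨a1, a2⟩ := ih' hx
      obtain ⟨b1, b2⟩ := ih' (x := x + 1) hxi.2
      obtain ⟨c1, c2⟩ := ih' (x := x - 1) (by omega)
      rw [hF s x hxi.1 hxi.2]
      have hp : 0 ≤ 1 - h x := by linarith [h1 x]
      have hh := h0 x
      rw [Nat.cast_sub hxi.1] at c1 c2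
      push_cast at b1 b2 c1 c2
      set q := (1 - 1 / (18 * (n : ℝ))) ^ s with hq
      have hq0 : 0 ≤ q := pow_nonneg hθ s
      have key : h x * ((2 - (x : ℝ) / n) * q) + (1 - h x) *
          (2 / 3 * ((2 - (x + 1 : ℝ) / n) * q) + 1 / 3 * ((2 - (x - 1 : ℝ) / n) * q)) ≤
          (2 - (x : ℝ) / n) * (1 - 1 / (18 * (n : ℝ))) ^ (s + 1) := by
        rw [pow_succ, ← hq]
        have e1 : h x * ((2 - (x : ℝ) / n) * q) + (1 - h x) *
          (2 / 3 * ((2 - (x + 1 : ℝ) / n) * q) + 1 / 3 * ((2 - (x - 1 : ℝ) / n) * q)) =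
          (2 - (x : ℝ) / n) * q - (1 - h x) / (3 * n) * q := by ring
        have e2 : (2 - (x : ℝ) / n) * (q * (1 - 1 / (18 * (n : ℝ)))) =
          (2 - (x : ℝ) / n) * q - (2 - (x : ℝ) / n) / (18 * n) * q := by ring
        rw [e1, e2]
        have : (2 - (x : ℝ) / n) / (18 * n) ≤ (1 - h x) / (3 * n) := by
          rw [div_le_div_iff₀ (by positivity) (by positivity)]
          have : (0 : ℝ) ≤ (x : ℝ) / n := by positivity
          nlinarith [h1 x]
        nlinarith [mul_le_mul_of_nonneg_right this hq0]
      have m1 := mul_le_mul_of_nonneg_left a1 hh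
      have m2 := mul_le_mul_of_nonneg_left a2 hh
      have m3 := mul_le_mul_of_nonneg_left (add_le_add
        (mul_le_mul_of_nonneg_left b1 (by norm_num : (0 : ℝ) ≤ 2 / 3))
        (mul_le_mul_of_nonneg_left c1 (by norm_num : (0 : ℝ) ≤ 1 / 3))) hp
      have m4 := mul_le_mul_of_nonneg_left (add_le_add
        (mul_le_mul_of_nonneg_left b2 (by norm_num : (0 : ℝ) ≤ 2 / 3))
        (mul_le_mul_of_nonneg_left c2 (by norm_num : (0 : ℝ) ≤ 1 / 3))) hp
      have key' := mul_le_mul_of_nonneg_left key hlo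
      constructor <;> linarith
    · have hT : 0 ≤ (2 - (x : ℝ) / n) * (1 - 1 / (18 * n)) ^ (s + 1) :=
        mul_nonneg (by linarith) (pow_nonneg hθ _)
      have hm : lo ≤ F (s + 1) x ∧ F (s + 1) x ≤ hi := by
        have := hb (s + 1) le_rfl
        rcases (by omega : x = 0 ∨ x = n) with rfl | rfl
        · exact this.1
        · exact this.2
      constructor
      · nlinarith [hm.1]
      · linarith [hm.2]

lemma tcHold_mem (n : ℕ) (x : TwoCycleState n) : 1 / 2 ≤ tcHold n x ∧ tcHold n x ≤ 2 / 3 := by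
  have := goldenAlpha_gt; have := goldenAlpha_lt
  rcases x with ⟨⟩ | ⟨i, j⟩ <;> simp only [tcHold]
  · norm_num
  · split_ifs
    · constructor <;> linarith
    · norm_num

lemma tcP_eq_holdChain (n : ℕ) : tcP n = holdChain n (tcHold n) := rfl

/-- Two-sided bounds for the return probabilities to `o` transfer to all pairs of states. -/
lemma tcP_pow_bounds_of_return {n : ℕ} (hn : 2 ≤ n) {lo hi : ℝ} (hlo : 0 ≤ lo) {M s m : ℕ}
    (hret : ∀ r, M ≤ r → r ≤ m → lo ≤ (tcP n ^ r) (Sum.inl ()) (Sum.inl ()) ∧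
      (tcP n ^ r) (Sum.inl ()) (Sum.inl ()) ≤ hi)
    (hm : M + 2 * s ≤ m) {T : ℝ} (hT : 2 * (1 - 1 / (18 * (n : ℝ))) ^ s ≤ T) (hT' : T ≤ 1 / 2)
    (x y : TwoCycleState n) :
    lo / 16 ≤ (tcP n ^ m) x y ∧ (tcP n ^ m) x y ≤ 3 * hi + 4 * T := by
  rw [tcP_eq_holdChain] at *
  have H0 : ∀ x, 0 ≤ tcHold n x := fun x => by linarith [(tcHold_mem n x).1]
  have H1 : ∀ x, tcHold n x ≤ 1 := fun x => by linarith [(tcHold_mem n x).2]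
  have hn' : (1 : ℝ) ≤ n := by exact_mod_cast (by omega : 1 ≤ n)
  have hθ : (0 : ℝ) ≤ 1 - 1 / (18 * n) := by
    rw [sub_nonneg, div_le_one (by positivity)]; linarith
  have hq0 := pow_nonneg hθ s
  have hT0 : 0 ≤ T := by linarith
  have hTx : ∀ {x : ℕ}, x ≤ n → (2 - (x : ℝ) / n) * (1 - 1 / (18 * n)) ^ s ≤ T := by
    intro x hx
    have : (0 : ℝ) ≤ (x : ℝ) / n := by positivity
    nlinarith
  have hhi : 0 ≤ hi := by have := hret m (by omega) le_rfl; linarith [this.1, this.2]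
  -- from `o` to an arbitrary state
  have hcol : ∀ r, M + s ≤ r → r ≤ m → lo / 8 ≤ (holdChain n (tcHold n) ^ r) (Sum.inl ()) y ∧
      (holdChain n (tcHold n) ^ r) (Sum.inl ()) y ≤ 3 * hi + 3 * T := by
    intro r hr hrm
    obtain ⟨i, j, hj, rfl⟩ := exists_tcPos y
    by_cases hj' : 0 < j ∧ j < n
    swap
    · have : tcPos n i j = Sum.inl () := by simp only [tcPos, dif_neg hj']
      rw [this]
      have := hret r (by omega) hrm
      constructor <;> linarith [this.1, this.2]
    let F : ℕ → ℕ → ℝ := fun t k => if 0 < k ∧ k < n then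
      (holdChain n (tcHold n) ^ (r - s + t)) (Sum.inl ()) (tcPos n i (n - k)) *
        (1 - tcHold n (tcPos n i (n - k)))
      else (holdChain n (tcHold n) ^ (r - s + t)) (Sum.inl ()) (Sum.inl ()) / 4
    have hrec : ∀ t k, 0 < k → k < n → F (t + 1) k = tcHold n (tcPos n i (n - k)) * F t k +
        (1 - tcHold n (tcPos n i (n - k))) * (2 / 3 * F t (k + 1) + 1 / 3 * F t (k - 1)) := by
      intro t k hk0 hkn
      have e1 : ∀ t, F t k = (holdChain n (tcHold n) ^ (r - s + t)) (Sum.inl ())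
          (tcPos n i (n - k)) * (1 - tcHold n (tcPos n i (n - k))) := by
        intro t; simp only [F, if_pos (And.intro hk0 hkn)]
      have e2 := sum_mul_tcStep (n := n)
        (fun x => (holdChain n (tcHold n) ^ (r - s + t)) (Sum.inl ()) x * (1 - tcHold n x))
        (fun k => F t (n - k)) i (by simp [F, tcHold]; ring) (by simp [F, tcHold]; ring)
        (by
          intro j hj0 hjn
          simp only [F, if_pos (show 0 < n - j ∧ n - j < n by omega)]
          rw [show n - (n - j) = j by omega])
        (j := n - k) (by omega) (by omega)
      simp only [show n - (n - k - 1) = k + 1 by omega, show n - (n - k + 1) = k - 1 by omega] at e2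
      rw [e1 (t + 1), ← add_assoc, pow_succ, Matrix.mul_apply, sum_holdChain, e2, e1 t]
      ring
    have hFn : ∀ k, k ≤ n → 0 ≤ F 0 k ∧ F 0 k ≤ 1 := by
      intro k hk
      simp only [F]
      split_ifs
      · have a0 := holdChain_pow_nonneg H0 H1 (r - s + 0) (Sum.inl ()) (tcPos n i (n - k))
        have a1 := holdChain_pow_le_one H0 H1 hn (r - s + 0) (Sum.inl ()) (tcPos n i (n - k))
        have := tcHold_mem n (tcPos n i (n - k))
        constructor
        · exact mul_nonneg a0 (by linarith [this.2])
        · exact mul_le_one₀ a1 (by linarith [this.2]) (by linarith [this.1])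
      · have a0 := holdChain_pow_nonneg H0 H1 (r - s + 0) (Sum.inl ()) (Sum.inl ())
        have a1 := holdChain_pow_le_one H0 H1 hn (r - s + 0) (Sum.inl ()) (Sum.inl ())
        constructor <;> linarith
    have hmain := arc_bounds (n := n) (h := fun k => tcHold n (tcPos n i (n - k)))
      (fun k => H0 _) (fun k => (tcHold_mem n _).2) (F := F) (lo := lo / 4) (hi := hi / 4) (by linarith) hrec
      (fun k hk => (hFn k hk).1) (fun k hk => (hFn k hk).2) (s := s) (by
        intro t ht
        have := hret (r - s + t) (by omega) (by omega)
        simp only [F, lt_irrefl, false_and, and_false, if_false]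
        refine ⟨⟨?_, ?_⟩, ?_, ?_⟩ <;> linarith [this.1, this.2])
      (x := n - j) (by omega)
    have hTj := hTx (x := n - j) (by omega)
    have eF : F s (n - j) = (holdChain n (tcHold n) ^ r) (Sum.inl ()) (tcPos n i j) *
        (1 - tcHold n (tcPos n i j)) := by
      simp only [F, if_pos (show 0 < n - j ∧ n - j < n by omega)]
      rw [show n - (n - j) = j by omega, show r - s + s = r by omega]
    rw [eF] at hmain
    have hh := tcHold_mem n (tcPos n i j)
    have a0 := holdChain_pow_nonneg H0 H1 r (Sum.inl ()) (tcPos n i j)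
    have m1 := mul_le_mul_of_nonneg_left hTj hlo
    constructor
    · nlinarith [hmain.1]
    · nlinarith [hmain.2]
  obtain ⟨i, j, hj, rfl⟩ := exists_tcPos x
  have hmain := arc_bounds (n := n) (h := fun k => tcHold n (tcPos n i k))
      (fun k => H0 _) (fun k => (tcHold_mem n _).2)
      (F := fun t k => (holdChain n (tcHold n) ^ (m - s + t)) (tcPos n i k) y)
      (lo := lo / 8) (hi := 3 * hi + 3 * T) (by linarith)
      (fun t k hk0 hkn => holdChain_pow_succ_pos _ i hk0 hkn y)
      (fun k hk => holdChain_pow_nonneg H0 H1 _ _ _)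
      (fun k hk => holdChain_pow_le_one H0 H1 hn _ _ _) (s := s) (by
        intro t ht
        have := hcol (m - s + t) (by omega) (by omega)
        simp only [tcPos_zero, tcPos_self]
        exact ⟨this, this⟩) hj
  simp only [show m - s + s = m by omega] at hmain
  have hTj := hTx hj
  have m1 := mul_le_mul_of_nonneg_left hTj hlo
  constructor
  · nlinarith [hmain.1]
  · nlinarith [hmain.2]

/-- Law of the time at which the `2/3`-`1/3` walk on `{0, …, b}` with holding `h`, killed at `0`,
reaches `b`: `hitLaw b h t x` is the probability, starting at `x`, to reach `b` first at time `t`. -/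
noncomputable def hitLaw (b : ℕ) (h : ℕ → ℝ) : ℕ → ℕ → ℝ
  | 0, x => if x = b then 1 else 0
  | t + 1, x => if 0 < x ∧ x < b then
      h x * hitLaw b h t x + (1 - h x) * (2 / 3 * hitLaw b h t (x + 1) +
        1 / 3 * hitLaw b h t (x - 1)) else 0

/-- Increments of the expected hitting time. -/
noncomputable def hitIncr (h : ℕ → ℝ) : ℕ → ℝ
  | 0 => 3
  | j + 1 => hitIncr h j / 2 + 3 / 2 * (1 / (1 - h (j + 1)))

/-- Expected time to reach `b` from `x` for the walk reflected suitably at `0`. -/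
noncomputable def hitMean (b : ℕ) (h : ℕ → ℝ) (x : ℕ) : ℝ := ∑ j ∈ Ico x b, hitIncr h j

section HitLaw

variable {b : ℕ} {h : ℕ → ℝ}

lemma hitLaw_zero (x : ℕ) : hitLaw b h 0 x = if x = b then 1 else 0 := rfl

lemma hitLaw_succ {x : ℕ} (hx : 0 < x) (hxb : x < b) (t : ℕ) :
    hitLaw b h (t + 1) x = h x * hitLaw b h t x + (1 - h x) *
      (2 / 3 * hitLaw b h t (x + 1) + 1 / 3 * hitLaw b h t (x - 1)) := by
  simp [hitLaw, hx, hxb]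

lemma hitLaw_succ_of_not {x : ℕ} (hx : ¬(0 < x ∧ x < b)) (t : ℕ) :
    hitLaw b h (t + 1) x = 0 := by
  simp only [hitLaw, if_neg hx]

lemma hitLaw_nonneg (h0 : ∀ x, 0 ≤ h x) (h1 : ∀ x, h x ≤ 1 / 4) (t x : ℕ) :
    0 ≤ hitLaw b h t x := by
  induction t generalizing x with
  | zero => rw [hitLaw_zero]; split_ifs <;> norm_num
  | succ t ih =>
    by_cases hx : 0 < x ∧ x < b
    · rw [hitLaw_succ hx.1 hx.2]
      have := h0 x; have := h1 x; have a := ih x; have := ih (x + 1); have := ih (x - 1)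
      have : 0 ≤ 1 - h x := by linarith
      positivity
    · rw [hitLaw_succ_of_not hx]

lemma hitLaw_eq_zero {t x : ℕ} (htx : t + x < b) : hitLaw b h t x = 0 := by
  induction t generalizing x with
  | zero => rw [hitLaw_zero, if_neg (by omega)]
  | succ t ih =>
    by_cases hx : 0 < x ∧ x < b
    · rw [hitLaw_succ hx.1 hx.2, ih (by omega), ih (by omega), ih (by omega)]; ring
    · rw [hitLaw_succ_of_not hx]

lemma hitIncr_mem (h0 : ∀ x, 0 ≤ h x) (h1 : ∀ x, h x ≤ 1 / 4) (j : ℕ) :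
    3 ≤ hitIncr h j ∧ hitIncr h j ≤ 4 := by
  induction j with
  | zero => norm_num [hitIncr]
  | succ j ih =>
    have := h0 (j + 1); have := h1 (j + 1)
    have e1 : 1 ≤ 1 / (1 - h (j + 1)) := by rw [le_div_iff₀ (by linarith)]; linarith
    have e2 : 1 / (1 - h (j + 1)) ≤ 4 / 3 := by
      rw [div_le_div_iff₀ (by linarith) (by norm_num)]; linarith
    simp only [hitIncr]
    constructor <;> linarith [ih.1, ih.2]

lemma hitMean_succ {x : ℕ} (hxb : x < b) :
    hitMean b h x = hitIncr h x + hitMean b h (x + 1) := by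
  unfold hitMean
  rw [Finset.sum_eq_sum_Ico_succ_bot hxb]

lemma hitMean_of_le {x : ℕ} (hxb : b ≤ x) : hitMean b h x = 0 := by
  unfold hitMean
  rw [Finset.Ico_eq_empty_of_le hxb, Finset.sum_empty]

lemma hitMean_nonneg (h0 : ∀ x, 0 ≤ h x) (h1 : ∀ x, h x ≤ 1 / 4) (x : ℕ) :
    0 ≤ hitMean b h x :=
  Finset.sum_nonneg fun j _ => by linarith [(hitIncr_mem h0 h1 j).1]

/-- Conservation of a test function of the form `1 - (s - a)^2 / v^2` is governed by this
one-step identity for quadratic functions of the expected hitting time. -/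
lemma hitMean_step (h0 : ∀ x, 0 ≤ h x) (h1 : ∀ x, h x ≤ 1 / 4) {x : ℕ} (hx : 0 < x)
    (hxb : x < b) (a : ℝ) :
    h x * ((hitMean b h x - a) ^ 2 + 25 * hitMean b h x) + (1 - h x) *
      (2 / 3 * ((hitMean b h (x + 1) - a) ^ 2 + 25 * hitMean b h (x + 1)) +
       1 / 3 * ((hitMean b h (x - 1) - a) ^ 2 + 25 * hitMean b h (x - 1))) ≤
      (hitMean b h x - (a + 1)) ^ 2 + 25 * hitMean b h x := by
  obtain ⟨y, rfl⟩ : ∃ y, x = y + 1 := ⟨x - 1, by omega⟩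
  rw [Nat.add_sub_cancel, hitMean_succ (x := y) (by omega), hitMean_succ (x := y + 1) hxb]
  have hd := hitIncr_mem h0 h1 y
  have hd' := hitIncr_mem h0 h1 (y + 1)
  have key : (1 - h (y + 1)) * (2 / 3 * hitIncr h (y + 1) - 1 / 3 * hitIncr h y) = 1 := by
    have : 1 - h (y + 1) ≠ 0 := by linarith [h1 (y + 1)]
    simp only [hitIncr]
    field_simp
    ring
  set p := 1 - h (y + 1) with hp
  have hh : h (y + 1) = 1 - p := by rw [hp]; ring
  have hp1 : p ≤ 1 := by linarith [h0 (y + 1)]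
  have hp0 : 3 / 4 ≤ p := by linarith [h1 (y + 1)]
  set D := hitIncr h (y + 1)
  set E := hitIncr h y
  set g := hitMean b h (y + 1 + 1)
  rw [hh]
  have sq1 : D ^ 2 ≤ 16 := by nlinarith
  have sq2 : E ^ 2 ≤ 16 := by nlinarith
  have e : (1 - p) * ((D + g - a) ^ 2 + 25 * (D + g)) +
        p * (2 / 3 * ((g - a) ^ 2 + 25 * g) + 1 / 3 * ((E + (D + g) - a) ^ 2 + 25 * (E + (D + g)))) =
      (D + g - a) ^ 2 + 25 * (D + g) - (2 * (D + g - a) + 25) *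
        (p * (2 / 3 * D - 1 / 3 * E)) + p * (2 / 3 * D ^ 2 + 1 / 3 * E ^ 2) := by ring
  rw [e, key]
  have : p * (2 / 3 * D ^ 2 + 1 / 3 * E ^ 2) ≤ 1 * 16 :=
    mul_le_mul hp1 (by linarith) (by positivity) (by norm_num)
  nlinarith

/-- Peeling off the first step in a weighted sum over hitting times. -/
lemma sum_hitLaw_succ {x : ℕ} (hx : 0 < x) (hxb : x < b) (f : ℕ → ℝ) (S : ℕ) :
    ∑ s ∈ range (S + 1), hitLaw b h s x * f s =
      h x * ∑ s ∈ range S, hitLaw b h s x * f (s + 1) + (1 - h x) *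
        (2 / 3 * ∑ s ∈ range S, hitLaw b h s (x + 1) * f (s + 1) +
         1 / 3 * ∑ s ∈ range S, hitLaw b h s (x - 1) * f (s + 1)) := by
  rw [Finset.sum_range_succ', hitLaw_zero, if_neg hxb.ne, zero_mul, add_zero]
  simp only [mul_sum, ← sum_add_distrib]
  refine sum_congr rfl fun s _ => ?_
  rw [hitLaw_succ hx hxb]
  ring

lemma sum_hitLaw_of_not {x : ℕ} (hx : ¬(0 < x ∧ x < b)) (f : ℕ → ℝ) (S : ℕ) :
    ∑ s ∈ range (S + 1), hitLaw b h s x * f s = if x = b then f 0 else 0 := by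
  rw [Finset.sum_range_succ', hitLaw_zero]
  rw [sum_eq_zero fun s _ => by rw [hitLaw_succ_of_not hx, zero_mul]]
  split_ifs <;> simp

lemma sum_hitLaw_le_one (h0 : ∀ x, 0 ≤ h x) (h1 : ∀ x, h x ≤ 1 / 4) (S x : ℕ) :
    ∑ s ∈ range S, hitLaw b h s x ≤ 1 := by
  induction S generalizing x with
  | zero => simp
  | succ S ih =>
    by_cases hx : 0 < x ∧ x < b
    · have e := sum_hitLaw_succ hx.1 hx.2 (h := h) (fun _ => 1) S
      simp only [mul_one] at e
      rw [e]
      nlinarith [ih x, ih (x + 1), ih (x - 1), h0 x, h1 x]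
    · have e := sum_hitLaw_of_not hx (h := h) (fun _ => 1) S
      simp only [mul_one] at e
      rw [e]; split_ifs <;> norm_num

lemma sum_hitLaw_sq_le (h0 : ∀ x, 0 ≤ h x) (h1 : ∀ x, h x ≤ 1 / 4) (S x : ℕ) (a : ℝ) :
    ∑ s ∈ range S, hitLaw b h s x * ((s : ℝ) - a) ^ 2 ≤
      (hitMean b h x - a) ^ 2 + 25 * hitMean b h x := by
  induction S generalizing x a with
  | zero =>
    have := hitMean_nonneg (b := b) h0 h1 x
    simp only [range_zero, sum_empty]; positivity
  | succ S ih =>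
    by_cases hx : 0 < x ∧ x < b
    · rw [sum_hitLaw_succ hx.1 hx.2 (h := h) (fun s => ((s : ℝ) - a) ^ 2) S]
      have st := hitMean_step h0 h1 hx.1 hx.2 (a - 1)
      have e : ∀ s : ℕ, (((s + 1 : ℕ) : ℝ) - a) ^ 2 = ((s : ℝ) - (a - 1)) ^ 2 := by
        intro s; push_cast; ring
      simp only [e]
      have i1 := mul_le_mul_of_nonneg_left (ih x (a - 1)) (h0 x)
      have i2 := ih (x + 1) (a - 1)
      have i3 := ih (x - 1) (a - 1)
      have hp : 0 ≤ 1 - h x := by linarith [h1 x]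
      have i4 := mul_le_mul_of_nonneg_left (add_le_add
        (mul_le_mul_of_nonneg_left i2 (by norm_num : (0 : ℝ) ≤ 2 / 3))
        (mul_le_mul_of_nonneg_left i3 (by norm_num : (0 : ℝ) ≤ 1 / 3))) hp
      rw [sub_add_cancel] at st
      linarith
    · rw [sum_hitLaw_of_not hx (h := h) (fun s => ((s : ℝ) - a) ^ 2) S]
      have := hitMean_nonneg (b := b) h0 h1 x
      split_ifs with hb
      · rw [hitMean_of_le hb.ge]; apply le_of_eq; push_cast; ring
      · positivity

lemma le_sum_hitLaw (h0 : ∀ x, 0 ≤ h x) (h1 : ∀ x, h x ≤ 1 / 4) {S x : ℕ} (hxb : x ≤ b)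
    {a v : ℝ} (hv : 0 < v) (hS : a + v ≤ S) :
    1 - ((hitMean b h x - a) ^ 2 + 25 * hitMean b h x) / v ^ 2 - (1 / 2) ^ x ≤
      ∑ s ∈ range S, hitLaw b h s x * (1 - ((s : ℝ) - a) ^ 2 / v ^ 2) := by
  induction S generalizing x a with
  | zero =>
    have hg := hitMean_nonneg (b := b) h0 h1 x
    simp only [range_zero, sum_empty]
    have : 1 ≤ ((hitMean b h x - a) ^ 2 + 25 * hitMean b h x) / v ^ 2 := by
      rw [one_le_div (by positivity)]
      push_cast at hS
      nlinarith
    have : (0 : ℝ) ≤ (1 / 2) ^ x := by positivity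
    linarith
  | succ S ih =>
    by_cases hx : 0 < x ∧ x < b
    · rw [sum_hitLaw_succ hx.1 hx.2 (h := h) (fun s => 1 - ((s : ℝ) - a) ^ 2 / v ^ 2) S]
      have st := hitMean_step h0 h1 hx.1 hx.2 (a - 1)
      have e : ∀ s : ℕ, (((s + 1 : ℕ) : ℝ) - a) ^ 2 = ((s : ℝ) - (a - 1)) ^ 2 := by
        intro s; push_cast; ring
      simp only [e]
      have hS' : a - 1 + v ≤ S := by push_cast at hS; linarith
      have i1 := mul_le_mul_of_nonneg_left (ih (x := x) (a := a - 1) hx.2.le hS') (h0 x)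
      have i2 := ih (x := x + 1) (a := a - 1) hx.2 hS'
      have i3 := ih (x := x - 1) (a := a - 1) (by omega) hS'
      have hp : 0 ≤ 1 - h x := by linarith [h1 x]
      have i4 := mul_le_mul_of_nonneg_left (add_le_add
        (mul_le_mul_of_nonneg_left i2 (by norm_num : (0 : ℝ) ≤ 2 / 3))
        (mul_le_mul_of_nonneg_left i3 (by norm_num : (0 : ℝ) ≤ 1 / 3))) hp
      rw [sub_add_cancel] at st
      refine le_trans ?_ (add_le_add i1 i4)
      have st' := div_le_div_of_nonneg_right st (sq_nonneg v)
      obtain ⟨y, rfl⟩ : ∃ y, x = y + 1 := ⟨x - 1, by omega⟩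
      simp only [Nat.add_sub_cancel] at st' ⊢
      set g0 := (hitMean b h (y + 1) - (a - 1)) ^ 2 + 25 * hitMean b h (y + 1)
      set g1 := (hitMean b h (y + 1 + 1) - (a - 1)) ^ 2 + 25 * hitMean b h (y + 1 + 1)
      set g2 := (hitMean b h y - (a - 1)) ^ 2 + 25 * hitMean b h y
      have e3 : (h (y + 1) * g0 + (1 - h (y + 1)) * (2 / 3 * g1 + 1 / 3 * g2)) / v ^ 2 =
        h (y + 1) * (g0 / v ^ 2) + (1 - h (y + 1)) *
          (2 / 3 * (g1 / v ^ 2) + 1 / 3 * (g2 / v ^ 2)) := by ring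
      rw [e3] at st'
      have p1 : (1 / 2 : ℝ) ^ (y + 1) = (1 / 2) ^ y / 2 := by ring
      have p2 : (1 / 2 : ℝ) ^ (y + 1 + 1) = (1 / 2) ^ y / 4 := by ring
      rw [p1, p2]
      linarith
    · rw [sum_hitLaw_of_not hx (h := h) (fun s => 1 - ((s : ℝ) - a) ^ 2 / v ^ 2) S]
      have hg := hitMean_nonneg (b := b) h0 h1 x
      split_ifs with hb
      · rw [hitMean_of_le hb.ge]
        have : (0 : ℝ) ≤ (1 / 2) ^ x := by positivity
        have e : ((0 : ℝ) - a) ^ 2 = (((0 : ℕ) : ℝ) - a) ^ 2 := by simp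
        rw [e, mul_zero, add_zero]
        linarith
      · have hx0 : x = 0 := by omega
        rw [hx0, pow_zero]
        have : 0 ≤ ((hitMean b h 0 - a) ^ 2 + 25 * hitMean b h 0) / v ^ 2 := by
          rw [hx0] at hg; positivity
        linarith

/-- Evolution on the interior of `{0, …, b}` dominates the contribution of first visits to `b`. -/
lemma sum_hitLaw_mul_le (h0 : ∀ x, 0 ≤ h x) (h1 : ∀ x, h x ≤ 1 / 4) {F : ℕ → ℕ → ℝ}
    (hF0 : ∀ t x, x ≤ b → 0 ≤ F t x)
    (hF : ∀ t x, 0 < x → x < b →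
      F (t + 1) x = h x * F t x + (1 - h x) * (2 / 3 * F t (x + 1) + 1 / 3 * F t (x - 1)))
    (t : ℕ) {x : ℕ} (hxb : x ≤ b) :
    ∑ s ∈ range (t + 1), hitLaw b h s x * F (t - s) b ≤ F t x := by
  induction t generalizing x with
  | zero =>
    simp only [zero_add, range_one, sum_singleton, hitLaw_zero]
    split_ifs with hb
    · simp [hb]
    · simpa using hF0 0 x hxb
  | succ t ih =>
    by_cases hx : 0 < x ∧ x < b
    · rw [sum_hitLaw_succ hx.1 hx.2 (h := h) (fun s => F (t + 1 - s) b) (t + 1)]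
      simp only [Nat.add_sub_add_right]
      rw [hF t x hx.1 hx.2]
      have i1 := mul_le_mul_of_nonneg_left (ih hxb) (h0 x)
      have hp : 0 ≤ 1 - h x := by linarith [h1 x]
      have i4 := mul_le_mul_of_nonneg_left (add_le_add
        (mul_le_mul_of_nonneg_left (ih (x := x + 1) hx.2) (by norm_num : (0 : ℝ) ≤ 2 / 3))
        (mul_le_mul_of_nonneg_left (ih (x := x - 1) (by omega)) (by norm_num : (0 : ℝ) ≤ 1 / 3))) hp
      linarith
    · rw [sum_hitLaw_of_not hx (h := h) (fun s => F (t + 1 - s) b) (t + 1)]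
      split_ifs with hb
      · simp [hb]
      · exact hF0 _ _ hxb

/-- Evolution on the interior of `{0, …, b}` is bounded by the contribution of first visits to `b`,
of visits to `0`, and of the initial data. -/
lemma le_sum_hitLaw_mul (h0 : ∀ x, 0 ≤ h x) (h1 : ∀ x, h x ≤ 1 / 4) {F : ℕ → ℕ → ℝ} {ω : ℝ}
    (hω : 0 ≤ ω) (hF0 : ∀ t x, x ≤ b → 0 ≤ F t x) (hF1 : ∀ t x, x ≤ b → F t x ≤ 1)
    (hFi : ∀ x, 0 < x → x < b → F 0 x ≤ ω * (3 / 4) ^ x)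
    (hF : ∀ t x, 0 < x → x < b →
      F (t + 1) x = h x * F t x + (1 - h x) * (2 / 3 * F t (x + 1) + 1 / 3 * F t (x - 1)))
    (t : ℕ) {x : ℕ} (hxb : x ≤ b) :
    F t x ≤ ∑ s ∈ range (t + 1), hitLaw b h s x * F (t - s) b + (1 / 2) ^ x +
      ω * (47 / 48) ^ t * (3 / 4) ^ x := by
  induction t generalizing x with
  | zero =>
    simp only [zero_add, range_one, sum_singleton, hitLaw_zero, pow_zero, mul_one, Nat.sub_zero]
    have p2 : (0 : ℝ) ≤ (1 / 2) ^ x := by positivity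
    have p3 : (0 : ℝ) ≤ ω * (3 / 4) ^ x := by positivity
    split_ifs with hb
    · subst hb; linarith
    · rcases Nat.eq_zero_or_pos x with hx0 | hx0
      · have := hF1 0 x hxb
        simp only [hx0, pow_zero] at *
        linarith
      · linarith [hFi x hx0 (by omega)]
  | succ t ih =>
    by_cases hx : 0 < x ∧ x < b
    · rw [sum_hitLaw_succ hx.1 hx.2 (h := h) (fun s => F (t + 1 - s) b) (t + 1)]
      simp only [Nat.add_sub_add_right]
      rw [hF t x hx.1 hx.2]
      have i1 := mul_le_mul_of_nonneg_left (ih hxb) (h0 x)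
      have hp : 0 ≤ 1 - h x := by linarith [h1 x]
      have i4 := mul_le_mul_of_nonneg_left (add_le_add
        (mul_le_mul_of_nonneg_left (ih (x := x + 1) hx.2) (by norm_num : (0 : ℝ) ≤ 2 / 3))
        (mul_le_mul_of_nonneg_left (ih (x := x - 1) (by omega)) (by norm_num : (0 : ℝ) ≤ 1 / 3))) hp
      refine (add_le_add i1 i4).trans ?_
      obtain ⟨y, rfl⟩ : ∃ y, x = y + 1 := ⟨x - 1, by omega⟩
      simp only [Nat.add_sub_cancel]
      have p1 : (1 / 2 : ℝ) ^ (y + 1) = (1 / 2) ^ y / 2 := by ring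
      have p2 : (1 / 2 : ℝ) ^ (y + 1 + 1) = (1 / 2) ^ y / 4 := by ring
      rw [p1, p2]
      have q0 : 0 ≤ ω * (47 / 48) ^ t * (3 / 4) ^ y := by positivity
      have q1 : ω * (47 / 48) ^ t * (3 / 4) ^ (y + 1) =
        3 / 4 * (ω * (47 / 48) ^ t * (3 / 4) ^ y) := by ring
      have q2 : ω * (47 / 48) ^ t * (3 / 4) ^ (y + 1 + 1) =
        9 / 16 * (ω * (47 / 48) ^ t * (3 / 4) ^ y) := by ring
      have q3 : ω * (47 / 48) ^ (t + 1) * (3 / 4) ^ (y + 1) =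
        47 / 64 * (ω * (47 / 48) ^ t * (3 / 4) ^ y) := by ring
      rw [q1, q2, q3]
      have q4 := mul_nonneg q0 (by linarith [h1 (y + 1)] : 0 ≤ 1 / 4 - h (y + 1))
      linarith
    · rw [sum_hitLaw_of_not hx (h := h) (fun s => F (t + 1 - s) b) (t + 1)]
      have p2 : (0 : ℝ) ≤ (1 / 2) ^ x := by positivity
      have p3 : (0 : ℝ) ≤ ω * (47 / 48) ^ (t + 1) * (3 / 4) ^ x := by positivity
      split_ifs with hb
      · simp only [Nat.sub_zero]
        subst hb; linarith
      · have hx0 : x = 0 := by omega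
        have := hF1 (t + 1) x hxb
        simp only [hx0, pow_zero] at *
        linarith

end HitLaw

lemma PowerSeries.coeff_mul_range (f g : PowerSeries ℝ) (s : ℕ) :
    (f * g).coeff s = ∑ i ∈ range (s + 1), f.coeff i * g.coeff (s - i) := by
  rw [PowerSeries.coeff_mul,
    Finset.Nat.sum_antidiagonal_eq_sum_range_succ (fun i j => f.coeff i * g.coeff j)]

lemma PowerSeries.sum_range_coeff_mul (f g : PowerSeries ℝ) (φ : ℕ → ℝ) (S : ℕ) :
    ∑ s ∈ range S, (f * g).coeff s * φ s =
      ∑ i ∈ range S, f.coeff i * ∑ j ∈ range (S - i), g.coeff j * φ (i + j) := by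
  have e := Finset.sum_range_diag_flip S (fun i j => f.coeff i * (g.coeff j * φ (i + j)))
  simp only [mul_sum]
  rw [← e]
  refine sum_congr rfl fun s _ => ?_
  rw [PowerSeries.coeff_mul_range, sum_mul]
  refine sum_congr rfl fun i hi => ?_
  have : i + (s - i) = s := by have := mem_range.1 hi; omega
  rw [this, mul_assoc]

/-- `f` generates a sub-probability distribution on `ℕ` with mass defect at most `ε`, concentrated
around `μ` with variance at most `V`, expressed through truncated quadratic functionals. -/
structure IsConcentrated (f : PowerSeries ℝ) (μ V ε : ℝ) : Prop where
  mean_nonneg : 0 ≤ μ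
  var_nonneg : 0 ≤ V
  defect_nonneg : 0 ≤ ε
  coeff_nonneg : ∀ s, 0 ≤ f.coeff s
  mass_le : ∀ S : ℕ, ∑ s ∈ range S, f.coeff s ≤ 1
  sq_le : ∀ (S : ℕ) (a : ℝ), ∑ s ∈ range S, f.coeff s * ((s : ℝ) - a) ^ 2 ≤ (μ - a) ^ 2 + V
  le_sq : ∀ (S : ℕ) (a v : ℝ), 0 < v → a + v ≤ S →
    1 - ((μ - a) ^ 2 + V) / v ^ 2 - ε ≤
      ∑ s ∈ range S, f.coeff s * (1 - ((s : ℝ) - a) ^ 2 / v ^ 2)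

namespace IsConcentrated

lemma mono {f : PowerSeries ℝ} {μ V ε V' ε' : ℝ} (hf : IsConcentrated f μ V ε)
    (hV : V ≤ V') (hε : ε ≤ ε') : IsConcentrated f μ V' ε' where
  mean_nonneg := hf.mean_nonneg
  var_nonneg := hf.var_nonneg.trans hV
  defect_nonneg := hf.defect_nonneg.trans hε
  coeff_nonneg := hf.coeff_nonneg
  mass_le := hf.mass_le
  sq_le S a := (hf.sq_le S a).trans (by linarith)
  le_sq S a v hv hS := by
    refine le_trans ?_ (hf.le_sq S a v hv hS)
    have : ((μ - a) ^ 2 + V) / v ^ 2 ≤ ((μ - a) ^ 2 + V') / v ^ 2 := by gcongr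
    linarith

lemma one : IsConcentrated 1 0 0 0 where
  mean_nonneg := le_rfl
  var_nonneg := le_rfl
  defect_nonneg := le_rfl
  coeff_nonneg s := by rw [PowerSeries.coeff_one]; split_ifs <;> norm_num
  mass_le S := by
    simp only [PowerSeries.coeff_one]
    rw [Finset.sum_ite_eq']
    split_ifs <;> norm_num
  sq_le S a := by
    simp only [PowerSeries.coeff_one, ite_mul, zero_mul, one_mul]
    rw [Finset.sum_ite_eq']
    split_ifs
    · simp
    · positivity
  le_sq S a v hv hS := by
    simp only [PowerSeries.coeff_one, ite_mul, zero_mul, one_mul]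
    rw [Finset.sum_ite_eq']
    split_ifs with h
    · simp
    · have : S = 0 := by simpa using h
      rw [this] at hS
      push_cast at hS
      have : 1 ≤ ((0 - a) ^ 2 + 0) / v ^ 2 := by
        rw [one_le_div (by positivity)]; nlinarith
      linarith

lemma mul {f g : PowerSeries ℝ} {μ V ε μ' V' ε' : ℝ} (hf : IsConcentrated f μ V ε)
    (hg : IsConcentrated g μ' V' ε') : IsConcentrated (f * g) (μ + μ') (V + V') (ε + ε') where
  mean_nonneg := add_nonneg hf.mean_nonneg hg.mean_nonneg
  var_nonneg := add_nonneg hf.var_nonneg hg.var_nonneg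
  defect_nonneg := add_nonneg hf.defect_nonneg hg.defect_nonneg
  coeff_nonneg s := by
    rw [PowerSeries.coeff_mul]
    exact sum_nonneg fun p _ => mul_nonneg (hf.coeff_nonneg _) (hg.coeff_nonneg _)
  mass_le S := by
    have e := PowerSeries.sum_range_coeff_mul f g (fun _ => 1) S
    simp only [mul_one] at e
    rw [e]
    refine le_trans (sum_le_sum fun i _ => ?_) (hf.mass_le S)
    exact mul_le_of_le_one_right (hf.coeff_nonneg i) (hg.mass_le _)
  sq_le S a := by
    rw [PowerSeries.sum_range_coeff_mul f g (fun s => ((s : ℝ) - a) ^ 2) S]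
    have key : ∀ i ∈ range S, f.coeff i * ∑ j ∈ range (S - i),
        g.coeff j * (((i + j : ℕ) : ℝ) - a) ^ 2 ≤
        f.coeff i * ((i : ℝ) - (a - μ')) ^ 2 + V' * f.coeff i := by
      intro i _
      have h1 := hg.sq_le (S - i) (a - i)
      have h2 : ∑ j ∈ range (S - i), g.coeff j * (((i + j : ℕ) : ℝ) - a) ^ 2 ≤
          ((i : ℝ) - (a - μ')) ^ 2 + V' := by
        refine le_trans (le_of_eq (sum_congr rfl fun j _ => ?_)) (h1.trans (le_of_eq ?_))
        · push_cast; ring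
        · ring
      nlinarith [mul_le_mul_of_nonneg_left h2 (hf.coeff_nonneg i)]
    refine (sum_le_sum key).trans ?_
    rw [sum_add_distrib, ← mul_sum]
    have h3 := hf.sq_le S (a - μ')
    have h4 := mul_le_mul_of_nonneg_left (hf.mass_le S) hg.var_nonneg
    have e : (μ - (a - μ')) ^ 2 = (μ + μ' - a) ^ 2 := by ring
    linarith
  le_sq S a v hv hS := by
    rw [PowerSeries.sum_range_coeff_mul f g (fun s => 1 - ((s : ℝ) - a) ^ 2 / v ^ 2) S]
    have key : ∀ i ∈ range S,
        f.coeff i * (1 - ((i : ℝ) - (a - μ')) ^ 2 / v ^ 2) - (V' / v ^ 2 + ε') * f.coeff i ≤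
        f.coeff i * ∑ j ∈ range (S - i),
          g.coeff j * (1 - (((i + j : ℕ) : ℝ) - a) ^ 2 / v ^ 2) := by
      intro i hi
      have hiS : i ≤ S := (mem_range.1 hi).le
      have h1 := hg.le_sq (S - i) (a - i) v hv (by rw [Nat.cast_sub hiS]; linarith)
      have h2 : (1 - ((i : ℝ) - (a - μ')) ^ 2 / v ^ 2) - (V' / v ^ 2 + ε') ≤
          ∑ j ∈ range (S - i), g.coeff j * (1 - (((i + j : ℕ) : ℝ) - a) ^ 2 / v ^ 2) := by
        refine le_trans (le_of_eq ?_) (h1.trans (le_of_eq (sum_congr rfl fun j _ => ?_)))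
        · ring
        · push_cast; ring
      nlinarith [mul_le_mul_of_nonneg_left h2 (hf.coeff_nonneg i)]
    refine le_trans ?_ (sum_le_sum key)
    rw [sum_sub_distrib, ← mul_sum]
    have h3 := hf.le_sq S (a - μ') v hv (by linarith [hg.mean_nonneg])
    have hpos : 0 ≤ V' / v ^ 2 + ε' :=
      add_nonneg (div_nonneg hg.var_nonneg (sq_nonneg v)) hg.defect_nonneg
    have h4 := mul_le_mul_of_nonneg_left (hf.mass_le S) hpos
    have e : ((μ - (a - μ')) ^ 2 + V) / v ^ 2 + V' / v ^ 2 =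
      ((μ + μ' - a) ^ 2 + (V + V')) / v ^ 2 := by ring
    linarith

lemma pow {f : PowerSeries ℝ} {μ V ε : ℝ} (hf : IsConcentrated f μ V ε) (k : ℕ) :
    IsConcentrated (f ^ k) (k * μ) (k * V) (k * ε) := by
  induction k with
  | zero => simpa using one
  | succ k ih =>
    rw [pow_succ]
    have := ih.mul hf
    push_cast
    simpa only [add_mul, one_mul] using this

end IsConcentrated

/-- Generating function of the hitting law. -/
noncomputable def hitSeries (b : ℕ) (h : ℕ → ℝ) (x : ℕ) : PowerSeries ℝ :=
  PowerSeries.mk fun t => hitLaw b h t x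

lemma isConcentrated_hitSeries {b : ℕ} {h : ℕ → ℝ} (h0 : ∀ x, 0 ≤ h x) (h1 : ∀ x, h x ≤ 1 / 4)
    {x : ℕ} (hxb : x ≤ b) :
    IsConcentrated (hitSeries b h x) (hitMean b h x) (25 * hitMean b h x) ((1 / 2) ^ x) where
  mean_nonneg := hitMean_nonneg h0 h1 x
  var_nonneg := mul_nonneg (by norm_num) (hitMean_nonneg h0 h1 x)
  defect_nonneg := by positivity
  coeff_nonneg s := by simpa [hitSeries] using hitLaw_nonneg h0 h1 s x
  mass_le S := by simpa [hitSeries] using sum_hitLaw_le_one h0 h1 S x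
  sq_le S a := by simpa [hitSeries] using sum_hitLaw_sq_le h0 h1 S x a
  le_sq S a v hv hS := by simpa only [hitSeries, PowerSeries.coeff_mk] using le_sum_hitLaw h0 h1 hxb hv hS

/-- Holding probabilities of the reduced chain `2 P - 1`. -/
noncomputable def redHold (n : ℕ) (x : TwoCycleState n) : ℝ := 2 * tcHold n x - 1

/-- Holding probabilities of the reduced chain along cycle `i`. -/
noncomputable def arcHold (n : ℕ) (i : Fin 2) (j : ℕ) : ℝ := redHold n (tcPos n i j)

/-- Return probabilities to `o` of the reduced chain. -/
noncomputable def redReturn (n t : ℕ) : ℝ :=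
  (holdChain n (redHold n) ^ t) (Sum.inl ()) (Sum.inl ())

lemma redHold_mem (n : ℕ) (x : TwoCycleState n) : 0 ≤ redHold n x ∧ redHold n x ≤ 1 / 4 := by
  have := goldenAlpha_gt; have := goldenAlpha_lt
  unfold redHold
  rcases x with ⟨⟩ | ⟨i, j⟩ <;> simp only [tcHold]
  · norm_num
  · split_ifs
    · constructor <;> linarith
    · norm_num

lemma redHold_inl (n : ℕ) (u : Unit) : redHold n (Sum.inl u) = 0 := by
  simp [redHold, tcHold]

lemma arcHold_eq {c : ℕ} {i : Fin 2} {j : ℕ} :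
    arcHold (4 * c) i j =
      if i = 0 ∧ 0 < j ∧ c ≤ j ∧ j ≤ 3 * c ∧ j < 4 * c then 2 * goldenAlpha - 1 else 0 := by
  unfold arcHold redHold
  by_cases hj : 0 < j ∧ j < 4 * c
  · rw [tcPos_of_mem hj.1 hj.2]
    simp only [tcHold]
    rw [Nat.sub_add_cancel hj.1, show 4 * c / 4 = c by omega, show 3 * (4 * c) / 4 = 3 * c by omega]
    simp only [hj.1, hj.2, true_and, and_true]
    split_ifs <;> norm_num
  · have : tcPos (4 * c) i j = Sum.inl () := by simp only [tcPos, dif_neg hj]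
    rw [this, if_neg (by tauto)]
    simp [tcHold]

lemma tcP_pow_eq_sum (n m : ℕ) (x y : TwoCycleState n) :
    (tcP n ^ m) x y = ∑ j ∈ range (m + 1), binProb m j * (holdChain n (redHold n) ^ j) x y := by
  have e : tcP n = (1 / 2 : ℝ) • (holdChain n (redHold n) + 1) := by
    ext x y
    simp only [tcP, holdChain, redHold, Matrix.smul_apply, Matrix.add_apply, Matrix.one_apply,
      smul_eq_mul]
    split_ifs <;> ring
  rw [e, smul_pow, (Commute.one_right _).add_pow, Matrix.smul_apply, Matrix.sum_apply,
    smul_eq_mul, mul_sum]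
  refine sum_congr rfl fun j _ => ?_
  rw [one_pow, mul_one, ← nsmul_eq_mul', Matrix.smul_apply,
    nsmul_eq_mul, binProb]
  simp only [one_div, inv_pow]
  ring

/-- Law of the duration of an excursion of the reduced chain that starts at `o` and ends at `o`
after completing cycle `i`. -/
noncomputable def excursion (c : ℕ) (i : Fin 2) : PowerSeries ℝ :=
  hitSeries (2 * c) (fun _ => 0) c * hitSeries (4 * c) (arcHold (4 * c) i) c

/-- The average of the excursion laws over the two cycles. -/
noncomputable def meanExcursion (c : ℕ) : PowerSeries ℝ :=
  (1 / 2 : ℝ) • (excursion c 0 + excursion c 1)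

section Renewal

variable {c : ℕ}

/-- Return probabilities as seen from the stem consisting of the last quarter of a cycle followed
by the first quarter of a uniformly chosen cycle; `o` is at position `c`. -/
noncomputable def stemReturn (c t x : ℕ) : ℝ :=
  ∑ i : Fin 2, 1 / 2 * (holdChain (4 * c) (redHold (4 * c)) ^ t)
    (tcPos (4 * c) i (if c ≤ x then x - c else 3 * c + x)) (Sum.inl ())

lemma stemReturn_self (t : ℕ) : stemReturn c t c = redReturn (4 * c) t := by
  simp [stemReturn, redReturn]

lemma redHold_nonneg (n : ℕ) (x : TwoCycleState n) : 0 ≤ redHold n x := (redHold_mem n x).1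

lemma redHold_le_one (n : ℕ) (x : TwoCycleState n) : redHold n x ≤ 1 :=
  (redHold_mem n x).2.trans (by norm_num)

lemma redPow_nonneg (n t : ℕ) (x y : TwoCycleState n) :
    0 ≤ (holdChain n (redHold n) ^ t) x y :=
  holdChain_pow_nonneg (redHold_nonneg n) (redHold_le_one n) t x y

lemma redPow_le_one {n : ℕ} (hn : 2 ≤ n) (t : ℕ) (x y : TwoCycleState n) :
    (holdChain n (redHold n) ^ t) x y ≤ 1 :=
  holdChain_pow_le_one (redHold_nonneg n) (redHold_le_one n) hn t x y

lemma stemReturn_nonneg (t x : ℕ) : 0 ≤ stemReturn c t x :=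
  sum_nonneg fun i _ => mul_nonneg (by norm_num) (redPow_nonneg _ _ _ _)

lemma stemReturn_le_one (hc : 1 ≤ c) (t x : ℕ) : stemReturn c t x ≤ 1 := by
  unfold stemReturn
  rw [Fin.sum_univ_two]
  linarith [redPow_le_one (show 2 ≤ 4 * c by omega) t
    (tcPos (4 * c) 0 (if c ≤ x then x - c else 3 * c + x)) (Sum.inl ()),
    redPow_le_one (show 2 ≤ 4 * c by omega) t
    (tcPos (4 * c) 1 (if c ≤ x then x - c else 3 * c + x)) (Sum.inl ())]

lemma stemReturn_succ (hc : 1 ≤ c) (t : ℕ) {x : ℕ} (hx : 0 < x) (hxb : x < 2 * c) :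
    stemReturn c (t + 1) x =
      2 / 3 * stemReturn c t (x + 1) + 1 / 3 * stemReturn c t (x - 1) := by
  rcases lt_trichotomy x c with h | h | h
  · have e : ∀ i : Fin 2, redHold (4 * c) (tcPos (4 * c) i (3 * c + x)) = 0 := by
      intro i
      have := arcHold_eq (c := c) (i := i) (j := 3 * c + x)
      rw [arcHold, if_neg (by omega)] at this
      exact this
    have e2 : ∀ i : Fin 2, tcPos (4 * c) i (if c ≤ x + 1 then x + 1 - c else 3 * c + (x + 1)) =
        tcPos (4 * c) i (3 * c + x + 1) := by
      intro i
      split_ifs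
      · rw [show x + 1 - c = 0 by omega, show 3 * c + x + 1 = 4 * c by omega]; simp
      · rfl
    simp only [stemReturn, e2, if_neg (show ¬ c ≤ x by omega), if_neg (show ¬ c ≤ x - 1 by omega),
      mul_sum, ← sum_add_distrib]
    refine sum_congr rfl fun i _ => ?_
    rw [holdChain_pow_succ_pos t i (by omega) (by omega), e, show 3 * c + x - 1 = 3 * c + (x - 1) by omega]
    ring
  · subst h
    rw [stemReturn_self, redReturn, holdChain_pow_succ_inl (by omega), redHold_inl]
    simp only [stemReturn, if_pos (show x ≤ x + 1 by omega), if_neg (show ¬ x ≤ x - 1 by omega),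
      mul_sum, ← sum_add_distrib]
    rw [show 3 * x + (x - 1) = 4 * x - 1 by omega, show x + 1 - x = 1 by omega]
    simp only [zero_mul, zero_add, sub_zero, one_mul]
    refine sum_congr rfl fun i _ => ?_
    ring
  · have e : ∀ i : Fin 2, redHold (4 * c) (tcPos (4 * c) i (x - c)) = 0 := by
      intro i
      have := arcHold_eq (c := c) (i := i) (j := x - c)
      rw [arcHold, if_neg (by omega)] at this
      exact this
    simp only [stemReturn, if_pos (show c ≤ x by omega), if_pos (show c ≤ x - 1 by omega),
      if_pos (show c ≤ x + 1 by omega), mul_sum, ← sum_add_distrib]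
    refine sum_congr rfl fun i _ => ?_
    rw [holdChain_pow_succ_pos t i (by omega) (by omega), e, show x - c + 1 = x + 1 - c by omega,
      show x - c - 1 = x - 1 - c by omega]
    ring

lemma stemReturn_zero (x : ℕ) (hx : 0 < x) (hxb : x < 2 * c) :
    stemReturn c 0 x ≤ (4 / 3) ^ c * (3 / 4) ^ x := by
  by_cases h : x = c
  · subst h
    rw [stemReturn_self, redReturn, ← mul_pow]
    norm_num
  · have : stemReturn c 0 x = 0 := by
      refine sum_eq_zero fun i _ => ?_
      rw [pow_zero, Matrix.one_apply_ne, mul_zero]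
      rw [tcPos_of_mem (by split_ifs <;> omega) (by split_ifs <;> omega)]
      simp
    rw [this]; positivity

lemma redPow_zero_pos (i : Fin 2) {n x : ℕ} (hx : 0 < x) (hxb : x < n) :
    (holdChain n (redHold n) ^ 0) (tcPos n i x) (Sum.inl ()) = 0 := by
  rw [pow_zero, Matrix.one_apply_ne]
  rw [tcPos_of_mem hx hxb]
  simp

/-- Generating function of the return probabilities of the reduced chain. -/
noncomputable def returnSeries (c : ℕ) : PowerSeries ℝ := PowerSeries.mk (redReturn (4 * c))

lemma coeff_meanExcursion_mul (f : PowerSeries ℝ) (t : ℕ) :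
    (meanExcursion c * f).coeff t = ∑ s ∈ range (t + 1), hitLaw (2 * c) (fun _ => 0) s c *
      ∑ i : Fin 2, 1 / 2 * ∑ r ∈ range (t - s + 1),
        hitLaw (4 * c) (arcHold (4 * c) i) r c * f.coeff (t - s - r) := by
  have e : meanExcursion c * f = hitSeries (2 * c) (fun _ => 0) c *
      (∑ i : Fin 2, (1 / 2 : ℝ) • (hitSeries (4 * c) (arcHold (4 * c) i) c * f)) := by
    simp only [meanExcursion, excursion, Fin.sum_univ_two, smul_mul_assoc, mul_smul_comm, add_mul,
      mul_add, smul_add, mul_assoc]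
  rw [e, PowerSeries.coeff_mul_range]
  refine sum_congr rfl fun s _ => ?_
  simp only [hitSeries, PowerSeries.coeff_mk, map_sum, PowerSeries.coeff_smul,
    PowerSeries.coeff_mul_range, smul_eq_mul]

lemma coeff_meanExcursion_mul_le (hc : 1 ≤ c) (t : ℕ) :
    (meanExcursion c * returnSeries c).coeff t ≤ redReturn (4 * c) t := by
  rw [coeff_meanExcursion_mul, ← stemReturn_self]
  have key := sum_hitLaw_mul_le (b := 2 * c) (h := fun _ => 0) (fun _ => le_rfl) (fun _ => by norm_num)
    (F := stemReturn c) (fun t x _ => stemReturn_nonneg t x)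
    (fun t x hx hxb => by rw [stemReturn_succ hc t hx hxb]; ring) t (x := c) (by omega)
  refine le_trans (sum_le_sum fun s _ => ?_) key
  refine mul_le_mul_of_nonneg_left ?_
    (hitLaw_nonneg (fun _ => le_rfl) (fun _ => by norm_num) s c)
  unfold stemReturn
  refine sum_le_sum fun i _ => mul_le_mul_of_nonneg_left ?_ (by norm_num)
  rw [if_pos (by omega), show 2 * c - c = c by omega]
  have := sum_hitLaw_mul_le (b := 4 * c) (h := arcHold (4 * c) i) (fun x => (redHold_mem _ _).1)
    (fun x => (redHold_mem _ _).2)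
    (F := fun t x => (holdChain (4 * c) (redHold (4 * c)) ^ t) (tcPos (4 * c) i x) (Sum.inl ()))
    (fun t x _ => redPow_nonneg _ _ _ _)
    (fun t x hx hxb => holdChain_pow_succ_pos t i hx hxb _) (t - s) (x := c) (by omega)
  simpa only [returnSeries, PowerSeries.coeff_mk, redReturn, tcPos_self] using this

lemma redReturn_le (hc : 1 ≤ c) (t : ℕ) :
    redReturn (4 * c) t ≤ (47 / 48) ^ t + 2 * (1 / 2) ^ c +
      (meanExcursion c * returnSeries c).coeff t := by
  rw [coeff_meanExcursion_mul, ← stemReturn_self]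
  have key := le_sum_hitLaw_mul (b := 2 * c) (h := fun _ => 0) (fun _ => le_rfl) (fun _ => by norm_num)
    (F := stemReturn c) (ω := (4 / 3) ^ c) (by positivity) (fun t x _ => stemReturn_nonneg t x)
    (fun t x _ => stemReturn_le_one hc t x) stemReturn_zero
    (fun t x hx hxb => by rw [stemReturn_succ hc t hx hxb]; ring) t (x := c) (by omega)
  have eω : (4 / 3 : ℝ) ^ c * (47 / 48) ^ t * (3 / 4) ^ c = (47 / 48) ^ t := by
    rw [mul_right_comm, ← mul_pow]; norm_num
  rw [eω] at key
  have inner : ∀ r, stemReturn c r (2 * c) ≤ ∑ i : Fin 2, 1 / 2 * ∑ q ∈ range (r + 1),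
      hitLaw (4 * c) (arcHold (4 * c) i) q c * (returnSeries c).coeff (r - q) + (1 / 2) ^ c := by
    intro r
    have : ∀ i : Fin 2, (holdChain (4 * c) (redHold (4 * c)) ^ r) (tcPos (4 * c) i c) (Sum.inl ()) ≤
        ∑ q ∈ range (r + 1),
          hitLaw (4 * c) (arcHold (4 * c) i) q c * (returnSeries c).coeff (r - q) + (1 / 2) ^ c := by
      intro i
      have := le_sum_hitLaw_mul (b := 4 * c) (h := arcHold (4 * c) i) (fun x => (redHold_mem _ _).1)
        (fun x => (redHold_mem _ _).2)
        (F := fun t x => (holdChain (4 * c) (redHold (4 * c)) ^ t) (tcPos (4 * c) i x) (Sum.inl ()))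
        (ω := 0) le_rfl
        (fun t x _ => redPow_nonneg _ _ _ _) (fun t x _ => redPow_le_one (by omega) _ _ _)
        (fun x hx hxb => by rw [redPow_zero_pos i hx hxb, zero_mul])
        (fun t x hx hxb => holdChain_pow_succ_pos t i hx hxb _) r (x := c) (by omega)
      simpa only [returnSeries, PowerSeries.coeff_mk, redReturn, tcPos_self, zero_mul, add_zero]
        using this
    unfold stemReturn
    rw [if_pos (by omega), show 2 * c - c = c by omega]
    simp only [Fin.sum_univ_two]
    linarith [this 0, this 1]
  refine key.trans ?_
  have s1 : ∑ s ∈ range (t + 1), hitLaw (2 * c) (fun _ => 0) s c * stemReturn c (t - s) (2 * c) ≤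
      ∑ s ∈ range (t + 1), (hitLaw (2 * c) (fun _ => 0) s c *
      ∑ i : Fin 2, 1 / 2 * ∑ r ∈ range (t - s + 1),
        hitLaw (4 * c) (arcHold (4 * c) i) r c * (returnSeries c).coeff (t - s - r) +
        (1 / 2) ^ c * hitLaw (2 * c) (fun _ => 0) s c) := by
    refine sum_le_sum fun s _ => ?_
    have := mul_le_mul_of_nonneg_left (inner (t - s))
      (hitLaw_nonneg (b := 2 * c) (h := fun _ => 0) (fun _ => le_rfl) (fun _ => by norm_num) s c)
    linarith
  rw [sum_add_distrib, ← mul_sum] at s1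
  have s2 := mul_le_mul_of_nonneg_left (sum_hitLaw_le_one (b := 2 * c) (h := fun _ => 0)
    (fun _ => le_rfl) (fun _ => by norm_num) (t + 1) c) (show (0 : ℝ) ≤ (1 / 2) ^ c by positivity)
  linarith

end Renewal

section Means

variable {c : ℕ}

lemma hitMean_add (b : ℕ) (h : ℕ → ℝ) {x : ℕ} (hxb : x < b) :
    hitMean b h (x + 1) = hitIncr h x - hitIncr h (b - 1) +
      3 * ∑ j ∈ Ico (x + 1) b, 1 / (1 - h j) := by
  induction b, Nat.succ_le_of_lt hxb using Nat.le_induction with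
  | base => simp [hitMean]
  | succ b hb ih =>
    have hx : x < b := hb
    have := ih hx
    unfold hitMean at this ⊢
    rw [sum_Ico_succ_top hb, sum_Ico_succ_top hb, this]
    obtain ⟨d, rfl⟩ : ∃ d, b = d + 1 := ⟨b - 1, by omega⟩
    simp only [Nat.add_sub_cancel, hitIncr]
    ring

lemma arcHold_nonneg (n : ℕ) (i : Fin 2) (x : ℕ) : 0 ≤ arcHold n i x := (redHold_mem _ _).1

lemma arcHold_le (n : ℕ) (i : Fin 2) (x : ℕ) : arcHold n i x ≤ 1 / 4 := (redHold_mem _ _).2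

lemma hitIncr_zero (h : ℕ → ℝ) (hh : ∀ x, h x = 0) (j : ℕ) : hitIncr h j = 3 := by
  induction j with
  | zero => rfl
  | succ j ih => simp only [hitIncr, ih, hh]; norm_num

lemma hitMean_zero (h : ℕ → ℝ) (hh : ∀ x, h x = 0) {b x : ℕ} (hxb : x ≤ b) :
    hitMean b h x = 3 * (b - x) := by
  simp only [hitMean, hitIncr_zero h hh, sum_const, Nat.card_Ico, nsmul_eq_mul]
  rw [Nat.cast_sub hxb]
  ring

lemma arcHold_one (x : ℕ) : arcHold (4 * c) 1 x = 0 := by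
  rw [arcHold_eq, if_neg (by simp)]

lemma abs_hitMean_arcHold_sub_le (hc : 2 ≤ c) :
    |hitMean (4 * c) (arcHold (4 * c) 0) c - (9 * c + 3 * c * goldenAlpha)| ≤ 2 := by
  obtain ⟨d, rfl⟩ : ∃ d, c = d + 1 := ⟨c - 1, by omega⟩
  rw [hitMean_add _ _ (by omega)]
  have m1 := hitIncr_mem (arcHold_nonneg (4 * (d + 1)) 0) (arcHold_le (4 * (d + 1)) 0) d
  have m2 := hitIncr_mem (arcHold_nonneg (4 * (d + 1)) 0) (arcHold_le (4 * (d + 1)) 0)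
    (4 * (d + 1) - 1)
  have g1 := goldenAlpha_gt
  have g2 := goldenAlpha_lt
  have hα : 1 / (1 - (2 * goldenAlpha - 1)) = 1 + goldenAlpha / 2 := by
    rw [div_eq_iff (by linarith)]
    linarith [goldenAlpha_sq]
  have e : ∑ j ∈ Ico (d + 1) (4 * (d + 1)), 1 / (1 - arcHold (4 * (d + 1)) 0 j) =
      3 * (d + 1) + (2 * (d + 1) + 1) * (goldenAlpha / 2) := by
    rw [← sum_Ico_consecutive _ (show d + 1 ≤ 3 * (d + 1) + 1 by omega)
      (show 3 * (d + 1) + 1 ≤ 4 * (d + 1) by omega)]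
    have a1 : ∑ j ∈ Ico (d + 1) (3 * (d + 1) + 1), 1 / (1 - arcHold (4 * (d + 1)) 0 j) =
        ∑ j ∈ Ico (d + 1) (3 * (d + 1) + 1), (1 + goldenAlpha / 2) := by
      refine sum_congr rfl fun j hj => ?_
      rw [mem_Ico] at hj
      rw [arcHold_eq, if_pos ⟨rfl, by omega, by omega, by omega, by omega⟩, hα]
    have a2 : ∑ j ∈ Ico (3 * (d + 1) + 1) (4 * (d + 1)), 1 / (1 - arcHold (4 * (d + 1)) 0 j) =
        ∑ j ∈ Ico (3 * (d + 1) + 1) (4 * (d + 1)), (1 : ℝ) := by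
      refine sum_congr rfl fun j hj => ?_
      rw [mem_Ico] at hj
      rw [arcHold_eq, if_neg (by omega)]
      norm_num
    rw [a1, a2, sum_const, sum_const, Nat.card_Ico, Nat.card_Ico,
      show 3 * (d + 1) + 1 - (d + 1) = 2 * (d + 1) + 1 by omega,
      show 4 * (d + 1) - (3 * (d + 1) + 1) = d by omega]
    simp only [nsmul_eq_mul]
    push_cast
    ring
  rw [e, abs_le]
  push_cast
  constructor <;> linarith [m1.1, m1.2, m2.1, m2.2]

lemma isConcentrated_excursion_one :
    IsConcentrated (excursion c 1) (12 * c) (400 * c) (2 * (1 / 2) ^ c) := by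
  have a := isConcentrated_hitSeries (b := 2 * c) (h := fun _ => 0) (fun _ => le_rfl)
    (fun _ => by norm_num) (x := c) (by omega)
  have b := isConcentrated_hitSeries (b := 4 * c) (arcHold_nonneg (4 * c) 1) (arcHold_le (4 * c) 1)
    (x := c) (by omega)
  rw [hitMean_zero _ (fun _ => rfl) (by omega)] at a
  rw [hitMean_zero _ arcHold_one (by omega)] at b
  have := a.mul b
  push_cast at this
  rw [show (3 * (2 * (c : ℝ) - c) + 3 * (4 * c - c)) = 12 * c by ring] at this
  refine this.mono ?_ (by linarith)
  have : (0 : ℝ) ≤ c := by positivity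
  linarith

lemma isConcentrated_excursion_zero (hc : 2 ≤ c) :
    ∃ μ, |μ - (12 * c + 3 * c * goldenAlpha)| ≤ 2 ∧
      IsConcentrated (excursion c 0) μ (400 * c) (2 * (1 / 2) ^ c) := by
  have a := isConcentrated_hitSeries (b := 2 * c) (h := fun _ => 0) (fun _ => le_rfl)
    (fun _ => by norm_num) (x := c) (by omega)
  have b := isConcentrated_hitSeries (b := 4 * c) (arcHold_nonneg (4 * c) 0) (arcHold_le (4 * c) 0)
    (x := c) (by omega)
  rw [hitMean_zero _ (fun _ => rfl) (by omega)] at a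
  have hm := abs_hitMean_arcHold_sub_le hc
  set γ := hitMean (4 * c) (arcHold (4 * c) 0) c
  have hγ : γ ≤ 13 * c := by
    have := (abs_le.1 hm).2
    have : (2 : ℝ) ≤ c := by exact_mod_cast hc
    nlinarith [goldenAlpha_lt]
  have := a.mul b
  push_cast at this
  refine ⟨_, ?_, this.mono ?_ (by linarith)⟩
  · rw [show (3 * (2 * (c : ℝ) - c) + γ - (12 * c + 3 * c * goldenAlpha)) =
      γ - (9 * c + 3 * c * goldenAlpha) by ring]
    exact hm
  · linarith

lemma isConcentrated_excursion_pow (hc : 2 ≤ c) {k k₁ : ℕ} (hk : k₁ ≤ k) :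
    ∃ μ, |μ - 3 * c * (4 * k + goldenAlpha * k₁)| ≤ 2 * k ∧
      IsConcentrated (excursion c 0 ^ k₁ * excursion c 1 ^ (k - k₁)) μ (400 * c * k)
        (2 * k * (1 / 2) ^ c) := by
  obtain ⟨μ, hμ, h0⟩ := isConcentrated_excursion_zero hc
  have hk' : (k₁ : ℝ) ≤ k := by exact_mod_cast hk
  have := (h0.pow k₁).mul ((isConcentrated_excursion_one (c := c)).pow (k - k₁))
  rw [Nat.cast_sub hk] at this
  refine ⟨_, ?_, this.mono (by linarith) (by linarith)⟩
  rw [show k₁ * μ + ((k : ℝ) - k₁) * (12 * c) - 3 * c * (4 * k + goldenAlpha * k₁) =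
    k₁ * (μ - (12 * c + 3 * c * goldenAlpha)) by ring, abs_mul, Nat.abs_cast]
  have : (0 : ℝ) ≤ k₁ := by positivity
  nlinarith

lemma meanExcursion_pow (k : ℕ) : meanExcursion c ^ k = ∑ k₁ ∈ range (k + 1),
    binProb k k₁ • (excursion c 0 ^ k₁ * excursion c 1 ^ (k - k₁)) := by
  rw [meanExcursion, smul_pow, add_pow, smul_sum]
  refine sum_congr rfl fun k₁ _ => ?_
  rw [mul_comm _ ((k.choose k₁ : PowerSeries ℝ)), ← nsmul_eq_mul, ← Nat.cast_smul_eq_nsmul ℝ,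
    smul_smul, binProb]
  congr 1
  simp only [one_div, inv_pow]
  ring

end Means

section Iterate

variable {c : ℕ}

lemma coeff_hitSeries (b : ℕ) (h : ℕ → ℝ) (x t : ℕ) :
    (hitSeries b h x).coeff t = hitLaw b h t x := PowerSeries.coeff_mk _ _

lemma PowerSeries.coeff_mul_le_coeff_mul {f g g' : PowerSeries ℝ} (hf : ∀ s, 0 ≤ f.coeff s)
    (hg : ∀ s, g.coeff s ≤ g'.coeff s) (t : ℕ) : (f * g).coeff t ≤ (f * g').coeff t := by
  rw [PowerSeries.coeff_mul, PowerSeries.coeff_mul]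
  exact sum_le_sum fun p _ => mul_le_mul_of_nonneg_left (hg _) (hf _)

lemma coeff_excursion_nonneg (i : Fin 2) (t : ℕ) : 0 ≤ (excursion c i).coeff t :=
  ((isConcentrated_hitSeries (b := 2 * c) (h := fun _ => 0) (fun _ => le_rfl)
    (fun _ => by norm_num) (x := c) (by omega)).mul
  (isConcentrated_hitSeries (b := 4 * c) (arcHold_nonneg (4 * c) i) (arcHold_le (4 * c) i)
    (x := c) (by omega))).coeff_nonneg t

lemma coeff_meanExcursion_nonneg (t : ℕ) : 0 ≤ (meanExcursion c).coeff t := by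
  rw [meanExcursion, PowerSeries.coeff_smul, map_add, smul_eq_mul]
  exact mul_nonneg (by norm_num)
    (add_nonneg (coeff_excursion_nonneg 0 t) (coeff_excursion_nonneg 1 t))

lemma coeff_meanExcursion_pow_nonneg (k t : ℕ) : 0 ≤ (meanExcursion c ^ k).coeff t := by
  induction k generalizing t with
  | zero => rw [pow_zero, PowerSeries.coeff_one]; split_ifs <;> norm_num
  | succ k ih =>
    rw [pow_succ, PowerSeries.coeff_mul]
    exact sum_nonneg fun p _ => mul_nonneg (ih _) (coeff_meanExcursion_nonneg _)

lemma coeff_meanExcursion_pow_le (hc : 1 ≤ c) (k t : ℕ) :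
    (meanExcursion c ^ k).coeff t ≤ redReturn (4 * c) t := by
  induction k generalizing t with
  | zero =>
    rw [pow_zero, PowerSeries.coeff_one]
    split_ifs with h
    · subst h; simp [redReturn]
    · exact redPow_nonneg _ _ _ _
  | succ k ih =>
    refine le_trans ?_ (coeff_meanExcursion_mul_le hc t)
    rw [pow_succ']
    refine PowerSeries.coeff_mul_le_coeff_mul coeff_meanExcursion_nonneg (fun s => ?_) t
    rw [returnSeries, PowerSeries.coeff_mk]
    exact ih s

lemma X_pow_dvd_meanExcursion : (PowerSeries.X : PowerSeries ℝ) ^ (4 * c) ∣ meanExcursion c := by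
  have key : ∀ i, (PowerSeries.X : PowerSeries ℝ) ^ (4 * c) ∣ excursion c i := by
    intro i
    rw [show 4 * c = c + 3 * c by ring, pow_add, excursion]
    refine mul_dvd_mul ?_ ?_ <;> rw [PowerSeries.X_pow_dvd_iff] <;> intro m hm <;>
      rw [coeff_hitSeries, hitLaw_eq_zero (by omega)]
  rw [PowerSeries.X_pow_dvd_iff]
  intro m hm
  rw [meanExcursion, PowerSeries.coeff_smul, map_add, PowerSeries.X_pow_dvd_iff.1 (key 0) m hm,
    PowerSeries.X_pow_dvd_iff.1 (key 1) m hm, add_zero, smul_zero]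

/-- Source term of the renewal inequality. -/
noncomputable def renewalSource (c : ℕ) : PowerSeries ℝ :=
  PowerSeries.mk fun t => (47 / 48 : ℝ) ^ t + 2 * (1 / 2) ^ c

lemma redReturn_le_sum (hc : 1 ≤ c) {K t : ℕ} (ht : t < 4 * c * K) :
    redReturn (4 * c) t ≤ ∑ k ∈ range K, (meanExcursion c ^ k * renewalSource c).coeff t := by
  have iter : ∀ K t, redReturn (4 * c) t ≤
      ∑ k ∈ range K, (meanExcursion c ^ k * renewalSource c).coeff t +
        (meanExcursion c ^ K * returnSeries c).coeff t := by
    intro K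
    induction K with
    | zero => intro t; simp [returnSeries]
    | succ K ih =>
      intro t
      refine (ih t).trans ?_
      rw [sum_range_succ, add_assoc]
      refine add_le_add le_rfl ?_
      rw [← map_add, pow_succ, mul_assoc, ← mul_add]
      refine PowerSeries.coeff_mul_le_coeff_mul (coeff_meanExcursion_pow_nonneg K) (fun s => ?_) t
      rw [map_add, returnSeries, renewalSource, PowerSeries.coeff_mk, PowerSeries.coeff_mk]
      exact redReturn_le hc s
  have := iter K t
  have hz : (meanExcursion c ^ K * returnSeries c).coeff t = 0 := by
    have hd : (PowerSeries.X : PowerSeries ℝ) ^ (4 * c * K) ∣ meanExcursion c ^ K * returnSeries c := by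
      rw [pow_mul]
      exact Dvd.dvd.mul_right (pow_dvd_pow_of_dvd X_pow_dvd_meanExcursion K) _
    exact PowerSeries.X_pow_dvd_iff.1 hd t ht
  rwa [hz, add_zero] at this

end Iterate

lemma half_pow_le_inv {c : ℕ} (hc : 1 ≤ c) : (1 / 2 : ℝ) ^ c ≤ 1 / c := by
  rw [one_div_pow]
  have h1 : (c : ℝ) ≤ 2 ^ c := by exact_mod_cast Nat.lt_two_pow_self.le
  have : (0 : ℝ) < c := by exact_mod_cast hc
  exact one_div_le_one_div_of_le this h1

/-- A number of excursions, and of those around the golden cycle, whose expected total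
duration is close to `m / 2` and which is typical for `k` fair coin tosses. -/
lemma exists_excursion_counts : ∃ W : ℝ, 1 ≤ W ∧ ∀ w : ℝ, W ≤ w → ∀ T : ℝ, w ^ 2 / 15 ≤ T →
    T ≤ 14 * w ^ 2 → ∃ k k₁ : ℕ, k₁ ≤ k ∧ |4 * k + goldenAlpha * k₁ - T| ≤ 20 / w ∧
      |(2 * k₁ - k : ℝ)| ≤ 26 * w ∧ w ^ 2 / 100 ≤ k ∧ (k : ℝ) ≤ 14 * w ^ 2 := by
  refine ⟨100000, by norm_num, fun w hw T hT1 hT2 => ?_⟩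
  have g1 := goldenAlpha_gt
  have g2 := goldenAlpha_lt
  set l : ℤ := ⌊T / (8 + goldenAlpha)⌋ with hl
  have hl1 : (l : ℝ) * (8 + goldenAlpha) ≤ T := by
    rw [← le_div_iff₀ (by linarith)]; exact Int.floor_le _
  have hl2 : T < (l + 1) * (8 + goldenAlpha) := by
    rw [← div_lt_iff₀ (by linarith)]; exact Int.lt_floor_add_one _
  obtain ⟨r, q, h1, h2⟩ := exists_golden_approx (by linarith : (1 : ℝ) ≤ w)
    (T - l * (8 + goldenAlpha))
  have hw2 : w * 100000 ≤ w ^ 2 := by nlinarith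
  have h20 : 20 / w ≤ 1 := by rw [div_le_one (by linarith)]; linarith
  have h1' := abs_le.1 h1
  have h2' := abs_le.1 h2
  have hαq : |goldenAlpha * (q : ℝ)| ≤ 5 * w := by
    rw [abs_mul, abs_of_pos (by linarith : 0 < goldenAlpha)]
    nlinarith [abs_nonneg (q : ℝ)]
  have hαq' := abs_le.1 hαq
  have hr1 : (r : ℝ) ≤ 10 * w := by linarith
  have hr2 : -(10 * w) ≤ (r : ℝ) := by linarith
  have hl3 : w ^ 2 / 140 ≤ (l : ℝ) := by nlinarith
  have hl4 : (l : ℝ) ≤ 2 * w ^ 2 := by nlinarith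
  have hk1 : 0 ≤ l + q := by
    have : (0 : ℝ) ≤ l + q := by linarith
    exact_mod_cast this
  have hk2 : l + q ≤ 2 * l + r := by
    have : (l + q : ℝ) ≤ 2 * l + r := by linarith
    exact_mod_cast this
  obtain ⟨k₁, hk₁⟩ := Int.eq_ofNat_of_zero_le hk1
  obtain ⟨k, hk⟩ := Int.eq_ofNat_of_zero_le (hk1.trans hk2)
  have ek₁ : (k₁ : ℝ) = l + q := by exact_mod_cast hk₁.symm
  have ek : (k : ℝ) = 2 * l + r := by exact_mod_cast hk.symm
  refine ⟨k, k₁, ?_, ?_, ?_, ?_, ?_⟩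
  · rw [hk₁, hk] at hk2; exact_mod_cast hk2
  · rw [ek, ek₁, show (4 * (2 * l + r) + goldenAlpha * (l + q) - T : ℝ) =
      4 * r + goldenAlpha * q - (T - l * (8 + goldenAlpha)) by ring]
    exact h1
  · rw [ek, ek₁, abs_le]; constructor <;> linarith
  · rw [ek]; linarith
  · rw [ek]; linarith

lemma binProb_mul_coeff_le {c : ℕ} (hc : 2 ≤ c) {k k₁ : ℕ} (hk : k₁ ≤ k) (j : ℕ) :
    binProb k k₁ * (excursion c 0 ^ k₁ * excursion c 1 ^ (k - k₁)).coeff j ≤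
      redReturn (4 * c) j := by
  refine le_trans ?_ (coeff_meanExcursion_pow_le (by omega) k j)
  simp only [meanExcursion_pow, map_sum, PowerSeries.coeff_smul, smul_eq_mul]
  refine single_le_sum (f := fun k₁ =>
    binProb k k₁ * (excursion c 0 ^ k₁ * excursion c 1 ^ (k - k₁)).coeff j)
    (fun i hi => ?_) (mem_range.2 (by omega))
  obtain ⟨_, _, hi'⟩ := isConcentrated_excursion_pow hc (Nat.lt_succ_iff.1 (mem_range.1 hi))
  exact mul_nonneg (binProb_nonneg _ _) (hi'.coeff_nonneg j)

set_option maxHeartbeats 800000 in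
lemma exists_le_return : ∃ δ > 0, ∃ W : ℝ, 1 ≤ W ∧ ∀ (c : ℕ) (w : ℝ), W ≤ w → w ^ 4 = c →
    ∀ m : ℕ, 2 / 5 * w ^ 6 ≤ m → (m : ℝ) ≤ 80 * w ^ 6 →
      δ / w ^ 4 ≤ (tcP (4 * c) ^ m) (Sum.inl ()) (Sum.inl ()) := by
  obtain ⟨W₁, hW₁, hcounts⟩ := exists_excursion_counts
  obtain ⟨δ₁, hδ₁, N₁, hbin₁⟩ := exists_le_binProb 260
  obtain ⟨δ₂, hδ₂, N₂, hbin₂⟩ := exists_le_binProb 1000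
  refine ⟨δ₁ / 4 * (δ₂ / 9 * (1 / 2)), by positivity, max W₁ (max 1250 (100 * max N₁ N₂)), by
    simp [hW₁], ?_⟩
  intro c w hw hwc m hm1 hm2
  rw [max_le_iff, max_le_iff] at hw
  obtain ⟨hw1, hw2, hw3⟩ := hw
  have hN₁ : (N₁ : ℝ) ≤ w / 100 := by
    have := le_max_left (N₁ : ℝ) N₂; push_cast at hw3; linarith
  have hN₂ : (N₂ : ℝ) ≤ w / 100 := by
    have := le_max_right (N₁ : ℝ) N₂; push_cast at hw3; linarith
  have hw0 : 0 < w := by linarith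
  have hw1' : 1 ≤ w := by linarith
  have hcR : (2 : ℝ) ≤ c := by
    rw [← hwc]; calc (2 : ℝ) ≤ w := by linarith
      _ ≤ w ^ 4 := le_self_pow₀ hw1' (by norm_num)
  have hc : 2 ≤ c := by exact_mod_cast hcR
  obtain ⟨k, k₁, hk, hkT, hkd, hk1, hk2⟩ := hcounts w hw1 (m / (6 * w ^ 4))
    (by rw [le_div_iff₀ (by positivity)]; nlinarith)
    (by rw [div_le_iff₀ (by positivity)]; nlinarith [pow_pos hw0 6])
  obtain ⟨μ, hμ, hconc⟩ := isConcentrated_excursion_pow hc hk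
  set f := excursion c 0 ^ k₁ * excursion c 1 ^ (k - k₁) with hf
  have hw3pos : 0 < w ^ 3 := by positivity
  have hw23 : w ^ 2 ≤ w ^ 3 := pow_le_pow_right₀ hw1' (by norm_num)
  -- the expected duration is within `100 w ^ 3` of `m / 2`
  have hμm : |μ - m / 2| ≤ 100 * w ^ 3 := by
    have e : 3 * (c : ℝ) * (4 * k + goldenAlpha * k₁) - m / 2 =
        3 * w ^ 4 * (4 * k + goldenAlpha * k₁ - m / (6 * w ^ 4)) := by
      rw [← hwc]; field_simp; ring
    have h2 : |3 * (c : ℝ) * (4 * k + goldenAlpha * k₁) - m / 2| ≤ 60 * w ^ 3 := by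
      rw [e, abs_mul, abs_of_pos (by positivity : 0 < 3 * w ^ 4)]
      calc 3 * w ^ 4 * |4 * k + goldenAlpha * k₁ - m / (6 * w ^ 4)| ≤ 3 * w ^ 4 * (20 / w) := by
            gcongr
        _ = 60 * w ^ 3 := by field_simp; ring
    have a := abs_le.1 hμ
    have b := abs_le.1 h2
    rw [abs_le]
    constructor <;> linarith [a.1, a.2, b.1, b.2]
  have hμm' := abs_le.1 hμm
  have hε : 2 * k * (1 / 2 : ℝ) ^ c ≤ 1 / 4 := by
    have h1 := half_pow_le_inv (by omega : 1 ≤ c)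
    rw [← hwc] at h1
    calc 2 * k * (1 / 2 : ℝ) ^ c ≤ 2 * (14 * w ^ 2) * (1 / w ^ 4) := by gcongr
      _ = 28 / w ^ 2 := by field_simp; ring
      _ ≤ 1 / 4 := by rw [div_le_div_iff₀ (by positivity) (by norm_num)]; nlinarith
  have hVv : (400 * c * k : ℝ) / (150 * w ^ 3) ^ 2 ≤ 1 / 4 := by
    rw [← hwc, div_le_div_iff₀ (by positivity) (by norm_num)]
    have : 400 * w ^ 4 * k ≤ 400 * w ^ 4 * (14 * w ^ 2) := by gcongr
    nlinarith [pow_pos hw0 6]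
  have hw36 : 1250 * w ^ 3 ≤ w ^ 6 := by
    have : 1250 ≤ w ^ 3 := by
      calc (1250 : ℝ) ≤ w := hw2
        _ ≤ w ^ 3 := le_self_pow₀ hw1' (by norm_num)
    nlinarith
  have hmass := hconc.le_sq (m + 1) μ (150 * w ^ 3) (by positivity) (by
    push_cast; linarith [hμm'.2])
  rw [sub_self, zero_pow two_ne_zero, zero_add] at hmass
  -- comparison of binomial weights with the quadratic test function
  have hsqm : 3 / 5 * w ^ 3 ≤ √m := by
    rw [Real.le_sqrt (by positivity) (by positivity)]
    have : (3 / 5 * w ^ 3) ^ 2 = 9 / 25 * w ^ 6 := by ring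
    linarith [pow_pos hw0 6]
  have hsqm' : √m ≤ 9 * w ^ 3 := by
    rw [Real.sqrt_le_left (by positivity)]
    have : (9 * w ^ 3) ^ 2 = 81 * w ^ 6 := by ring
    linarith [pow_pos hw0 6]
  have hmN : N₂ ≤ m := by
    have : (N₂ : ℝ) ≤ m := by
      have : w ≤ w ^ 6 := le_self_pow₀ hw1' (by norm_num)
      linarith
    exact_mod_cast this
  have hbinm : ∀ j : ℕ, δ₂ / 9 / w ^ 3 * (1 - ((j : ℝ) - μ) ^ 2 / (150 * w ^ 3) ^ 2) ≤ binProb m j := by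
    intro j
    by_cases hj : |(j : ℝ) - μ| ≤ 150 * w ^ 3
    · have hj' := abs_le.1 hj
      have := hbin₂ m hmN j (by
        rw [abs_le]; constructor <;> linarith [hj'.1, hj'.2, hμm'.1, hμm'.2])
      refine le_trans ?_ this
      calc δ₂ / 9 / w ^ 3 * (1 - ((j : ℝ) - μ) ^ 2 / (150 * w ^ 3) ^ 2) ≤ δ₂ / 9 / w ^ 3 * 1 := by
            gcongr
            have : 0 ≤ ((j : ℝ) - μ) ^ 2 / (150 * w ^ 3) ^ 2 := by positivity
            linarith
        _ = δ₂ / (9 * w ^ 3) := by field_simp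
        _ ≤ δ₂ / √m := div_le_div_of_nonneg_left hδ₂.le (by linarith) hsqm'
    · refine le_trans ?_ (binProb_nonneg m j)
      refine mul_nonpos_of_nonneg_of_nonpos (by positivity) ?_
      rw [sub_nonpos, one_le_div (by positivity)]
      rw [← sq_abs ((j : ℝ) - μ)]
      exact pow_le_pow_left₀ (by positivity) (not_le.1 hj).le 2
  have hsum : δ₂ / 9 / w ^ 3 * (1 / 2) ≤ ∑ j ∈ range (m + 1), binProb m j * f.coeff j := by
    calc δ₂ / 9 / w ^ 3 * (1 / 2) ≤ δ₂ / 9 / w ^ 3 * ∑ s ∈ range (m + 1),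
          f.coeff s * (1 - ((s : ℝ) - μ) ^ 2 / (150 * w ^ 3) ^ 2) := by
          gcongr
          linarith
      _ = ∑ s ∈ range (m + 1),
          (δ₂ / 9 / w ^ 3 * (1 - ((s : ℝ) - μ) ^ 2 / (150 * w ^ 3) ^ 2)) * f.coeff s := by
          rw [mul_sum]; exact sum_congr rfl fun s _ => by ring
      _ ≤ _ := sum_le_sum fun s _ =>
          mul_le_mul_of_nonneg_right (hbinm s) (hconc.coeff_nonneg s)
  -- probability of the chosen composition
  have hsqk : w / 10 ≤ √k := by
    rw [Real.le_sqrt (by positivity) (by positivity)]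
    linarith [(by ring : (w / 10) ^ 2 = w ^ 2 / 100)]
  have hsqk' : √k ≤ 4 * w := by
    rw [Real.sqrt_le_left (by positivity)]
    linarith [(by ring : (4 * w) ^ 2 = 16 * w ^ 2), sq_nonneg w]
  have hkN : N₁ ≤ k := by
    have : (N₁ : ℝ) ≤ k := by
      have : w ≤ w ^ 2 := le_self_pow₀ hw1' (by norm_num)
      linarith
    exact_mod_cast this
  have hbink : δ₁ / 4 / w ≤ binProb k k₁ := by
    refine le_trans ?_ (hbin₁ k hkN k₁ (by linarith))
    rw [div_div]
    exact div_le_div_of_nonneg_left hδ₁.le (by linarith) hsqk'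
  rw [tcP_pow_eq_sum]
  calc δ₁ / 4 * (δ₂ / 9 * (1 / 2)) / w ^ 4 = δ₁ / 4 / w * (δ₂ / 9 / w ^ 3 * (1 / 2)) := by
        field_simp
    _ ≤ binProb k k₁ * ∑ j ∈ range (m + 1), binProb m j * f.coeff j := by
        gcongr
        exact binProb_nonneg _ _
    _ = ∑ j ∈ range (m + 1), binProb m j * (binProb k k₁ * f.coeff j) := by
        rw [mul_sum]; exact sum_congr rfl fun j _ => by ring
    _ ≤ _ := sum_le_sum fun j _ => mul_le_mul_of_nonneg_left (binProb_mul_coeff_le hc hk j)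
        (binProb_nonneg m j)

lemma sq_le_four_mul_two_pow (c : ℕ) : c ^ 2 ≤ 4 * 2 ^ c := by
  rcases lt_or_ge c 3 with h | h
  · interval_cases c <;> norm_num
  · induction c, h using Nat.le_induction with
    | base => norm_num
    | succ c hc ih => rw [pow_succ 2 c]; nlinarith

lemma half_pow_le_inv_sq {c : ℕ} (hc : 1 ≤ c) : (1 / 2 : ℝ) ^ c ≤ 4 / (c : ℝ) ^ 2 := by
  have h : (c : ℝ) ^ 2 ≤ 4 * 2 ^ c := by exact_mod_cast sq_le_four_mul_two_pow c
  have : (0 : ℝ) < c := by exact_mod_cast hc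
  rw [one_div_pow, div_le_div_iff₀ (by positivity) (by positivity)]
  linarith

lemma binProb_le_cauchyProfile {N : ℕ} {u a b : ℝ} (hu : 0 < u) (ha : 0 < a) (ha1 : a ≤ 1)
    (hb : 0 ≤ b) (h1 : a * u ^ 2 ≤ N) (h2 : (N : ℝ) ≤ (b * u) ^ 2) (j : ℕ) :
    binProb N j ≤ 48 * b / a / u * cauchyProfile ((2 * j - N) / u) := by
  have hN : 0 < (N : ℝ) := lt_of_lt_of_le (by positivity) h1
  have hs : √N ≤ b * u := (Real.sqrt_le_left (by positivity)).2 h2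
  refine (binProb_le (by exact_mod_cast hN) j).trans ?_
  have hd : a * (u ^ 2 + (2 * j - N) ^ 2) ≤ N + (2 * j - N : ℝ) ^ 2 := by
    nlinarith [sq_nonneg (2 * j - N : ℝ)]
  calc 48 * √N / (N + (2 * j - N : ℝ) ^ 2)
      ≤ 48 * (b * u) / (a * (u ^ 2 + (2 * j - N) ^ 2)) := by gcongr
    _ = _ := by unfold cauchyProfile; field_simp

lemma IsConcentrated.sum_cauchyProfile_le {f : PowerSeries ℝ} {μ V ε : ℝ}
    (hf : IsConcentrated f μ V ε) {v : ℝ} (hv : 0 < v) (x : ℝ) (S : ℕ) :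
    ∑ s ∈ range S, f.coeff s * cauchyProfile ((s - x) / v) ≤
      2 * (1 + V / v ^ 2) * cauchyProfile ((μ - x) / v) := by
  have hsq := hf.sq_le S μ
  have hp := cauchyProfile_pos ((μ - x) / v)
  calc ∑ s ∈ range S, f.coeff s * cauchyProfile ((s - x) / v)
      ≤ ∑ s ∈ range S, f.coeff s *
          (2 * (1 + ((s - μ) / v) ^ 2) * cauchyProfile ((μ - x) / v)) := by
        refine sum_le_sum fun s _ => mul_le_mul_of_nonneg_left ?_ (hf.coeff_nonneg s)
        have := cauchyProfile_le ((s - x) / v) ((μ - x) / v)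
        rwa [← sub_div, sub_sub_sub_cancel_right] at this
    _ = 2 * (∑ s ∈ range S, f.coeff s + (∑ s ∈ range S, f.coeff s * ((s : ℝ) - μ) ^ 2) / v ^ 2) *
          cauchyProfile ((μ - x) / v) := by
        rw [sum_div, ← sum_add_distrib, mul_sum, sum_mul]
        exact sum_congr rfl fun s _ => by rw [div_pow]; ring
    _ ≤ _ := by
        gcongr
        · exact hf.mass_le S
        · simpa using hsq

lemma exists_sum_geometric_cauchyProfile_le : ∃ D : ℝ, 0 < D ∧ ∀ (x : ℝ) (v : ℝ), 1 ≤ v →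
    ∀ S : ℕ, ∑ s ∈ range S, (47 / 48 : ℝ) ^ s * cauchyProfile (x + s / v) ≤
      D * cauchyProfile x := by
  have h0 : Summable fun s : ℕ => (47 / 48 : ℝ) ^ s :=
    summable_geometric_of_lt_one (by norm_num) (by norm_num)
  have h2 : Summable fun s : ℕ => (s : ℝ) ^ 2 * (47 / 48 : ℝ) ^ s :=
    summable_pow_mul_geometric_of_norm_lt_one 2 (by norm_num)
  have h : Summable fun s : ℕ => 2 * ((47 / 48 : ℝ) ^ s + (s : ℝ) ^ 2 * (47 / 48 : ℝ) ^ s) :=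
    (h0.add h2).mul_left 2
  refine ⟨_, h.tsum_pos (fun s => by positivity) 0 (by norm_num), fun x v hv S => ?_⟩
  refine le_trans ?_ (mul_le_mul_of_nonneg_right
    (h.sum_le_tsum (range S) fun s _ => by positivity) (cauchyProfile_pos x).le)
  rw [sum_mul]
  refine sum_le_sum fun s _ => ?_
  have h1 := cauchyProfile_le (x + s / v) x
  have h3 : ((s : ℝ) / v) ^ 2 ≤ s ^ 2 :=
    pow_le_pow_left₀ (by positivity) (div_le_self (by positivity) hv) 2
  rw [add_sub_cancel_left] at h1
  calc (47 / 48 : ℝ) ^ s * cauchyProfile (x + s / v)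
      ≤ (47 / 48 : ℝ) ^ s * (2 * (1 + (s : ℝ) ^ 2) * cauchyProfile x) := by
        refine mul_le_mul_of_nonneg_left (h1.trans ?_) (by positivity)
        have := (cauchyProfile_pos x).le
        gcongr
    _ = _ := by ring

lemma exists_sum_renewal_le : ∃ D : ℝ, 0 < D ∧ ∀ (c : ℕ) (f : PowerSeries ℝ) (μ V ε : ℝ),
    IsConcentrated f μ V ε → ∀ (v : ℝ), 1 ≤ v → ∀ (m : ℕ) (x B : ℝ), 0 ≤ B →
    (∀ j, binProb m j ≤ B * cauchyProfile ((j - x) / v)) →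
    ∑ j ∈ range (m + 1), binProb m j * (f * renewalSource c).coeff j ≤
      B * (D * (1 + V / v ^ 2) * cauchyProfile ((μ - x) / v)) + 2 * (1 / 2) ^ c := by
  obtain ⟨D, hD, hgeo⟩ := exists_sum_geometric_cauchyProfile_le
  refine ⟨2 * D, by positivity, fun c f μ V ε hf v hv m x B hB hbin => ?_⟩
  have hv0 : 0 < v := by linarith
  have hsplit : renewalSource c = PowerSeries.mk (fun t => (47 / 48 : ℝ) ^ t) +
      PowerSeries.mk (fun _ => 2 * (1 / 2 : ℝ) ^ c) := rfl
  have hgeom : ∑ j ∈ range (m + 1), binProb m j *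
      (f * PowerSeries.mk (fun t => (47 / 48 : ℝ) ^ t)).coeff j ≤
      B * (2 * D * (1 + V / v ^ 2) * cauchyProfile ((μ - x) / v)) := by
    calc ∑ j ∈ range (m + 1), binProb m j *
          (f * PowerSeries.mk (fun t => (47 / 48 : ℝ) ^ t)).coeff j
        ≤ ∑ j ∈ range (m + 1), (f * PowerSeries.mk (fun t => (47 / 48 : ℝ) ^ t)).coeff j *
            (B * cauchyProfile ((j - x) / v)) := by
          refine sum_le_sum fun j _ => ?_
          rw [mul_comm]
          refine mul_le_mul_of_nonneg_left (hbin j) ?_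
          rw [PowerSeries.coeff_mul]
          refine sum_nonneg fun p _ => mul_nonneg (hf.coeff_nonneg _) ?_
          rw [PowerSeries.coeff_mk]; positivity
      _ = B * ∑ i ∈ range (m + 1), f.coeff i * ∑ s ∈ range (m + 1 - i),
            (47 / 48 : ℝ) ^ s * cauchyProfile ((i - x) / v + s / v) := by
          rw [PowerSeries.sum_range_coeff_mul f _ (fun j => B * cauchyProfile ((j - x) / v)),
            mul_sum]
          refine sum_congr rfl fun i _ => ?_
          rw [mul_left_comm, mul_sum _ _ B]
          congr 1
          refine sum_congr rfl fun s _ => ?_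
          rw [PowerSeries.coeff_mk, ← add_div, mul_left_comm]
          push_cast
          rw [add_sub_right_comm]
      _ ≤ B * ∑ i ∈ range (m + 1), f.coeff i * (D * cauchyProfile ((i - x) / v)) := by
          gcongr with i _
          · exact hf.coeff_nonneg i
          · exact hgeo _ v hv _
      _ = B * (D * ∑ i ∈ range (m + 1), f.coeff i * cauchyProfile ((i - x) / v)) := by
          rw [mul_sum _ _ D]
          congr 1
          exact sum_congr rfl fun i _ => by ring
      _ ≤ B * (D * (2 * (1 + V / v ^ 2) * cauchyProfile ((μ - x) / v))) := by
          gcongr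
          exact hf.sum_cauchyProfile_le hv0 x _
      _ = _ := by ring
  have hconst : ∑ j ∈ range (m + 1), binProb m j *
      (f * PowerSeries.mk (fun _ => 2 * (1 / 2 : ℝ) ^ c)).coeff j ≤ 2 * (1 / 2) ^ c := by
    calc _ ≤ ∑ j ∈ range (m + 1), binProb m j * (2 * (1 / 2 : ℝ) ^ c) := by
          refine sum_le_sum fun j _ => mul_le_mul_of_nonneg_left ?_ (binProb_nonneg m j)
          rw [PowerSeries.coeff_mul_range]
          simp only [PowerSeries.coeff_mk]
          rw [← sum_mul]
          exact mul_le_of_le_one_left (by positivity) (hf.mass_le _)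
      _ = _ := by rw [← sum_mul, sum_binProb, one_mul]
  rw [hsplit, mul_add]
  simp only [map_add, mul_add, sum_add_distrib]
  linarith

/-- The Gaussian-type lattice sum over numbers of excursions around the two cycles. -/
lemma exists_sum_excursion_counts_le : ∃ C : ℝ, 0 < C ∧ ∀ w : ℝ, 1 ≤ w → ∀ x : ℝ, w ^ 3 / 5 ≤ x →
    ∀ K : ℕ, (K : ℝ) ≤ 21 * w ^ 2 →
      ∑ k ∈ range K, ∑ k₁ ∈ range (k + 1),
        binProb k k₁ * cauchyProfile (3 * w * (4 * k + goldenAlpha * k₁) - x) ≤ C / w := by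
  obtain ⟨C, hC, hlat⟩ := exists_lattice_sum_le
  refine ⟨24000 * C + 6300, by positivity, fun w hw x hx K hK => ?_⟩
  have hw0 : 0 < w := by linarith
  have hterm : ∀ k ∈ range K, ∀ k₁ ∈ range (k + 1),
      binProb k k₁ * cauchyProfile (3 * w * (4 * k + goldenAlpha * k₁) - x) ≤
        24000 / w * (cauchyProfile (3 * w * (4 * k + goldenAlpha * k₁) - x) *
          cauchyProfile ((2 * k₁ - k) / w)) + binProb k k₁ * (300 / w ^ 6) := by
    intro k hk k₁ hk₁
    have hp := cauchyProfile_pos (3 * w * (4 * k + goldenAlpha * k₁) - x)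
    have hp' := cauchyProfile_pos ((2 * k₁ - k) / w)
    have hb := binProb_nonneg k k₁
    rcases le_or_gt (w ^ 2 / 100) (k : ℝ) with h | h
    · have hkK : (k : ℝ) ≤ K := by exact_mod_cast (mem_range.1 hk).le
      have hbin := binProb_le_cauchyProfile (N := k) (a := 1 / 100) (b := 5) hw0 (by norm_num)
        (by norm_num) (by norm_num) (by linarith)
        (by linarith [(by ring : (5 * w) ^ 2 = 25 * w ^ 2), sq_nonneg w]) k₁
      have : 0 ≤ binProb k k₁ * (300 / w ^ 6) := by positivity
      calc _ ≤ 48 * 5 / (1 / 100) / w * cauchyProfile ((2 * k₁ - k) / w) *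
            cauchyProfile (3 * w * (4 * k + goldenAlpha * k₁) - x) := by gcongr
        _ = 24000 / w * (cauchyProfile (3 * w * (4 * k + goldenAlpha * k₁) - x) *
          cauchyProfile ((2 * k₁ - k) / w)) := by norm_num; ring
        _ ≤ _ := by linarith
    · have hk₁k : (k₁ : ℝ) ≤ k := by exact_mod_cast Nat.lt_succ_iff.1 (mem_range.1 hk₁)
      have hk₁0 : (0 : ℝ) ≤ k₁ := by positivity
      have g1 := goldenAlpha_gt
      have g2 := goldenAlpha_lt
      have hX : w ^ 3 * (3 / 50) ≤ x - 3 * w * (4 * k + goldenAlpha * k₁) := by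
        have : 4 * k + goldenAlpha * k₁ ≤ 4.6185 * (w ^ 2 / 100) := by nlinarith
        have : 3 * w * (4 * k + goldenAlpha * k₁) ≤ 3 * w * (4.6185 * (w ^ 2 / 100)) := by gcongr
        have e : 3 * w * (4.6185 * (w ^ 2 / 100)) = 0.138555 * w ^ 3 := by ring
        linarith [pow_pos hw0 3]
      have hsmall : cauchyProfile (3 * w * (4 * k + goldenAlpha * k₁) - x) ≤ 300 / w ^ 6 := by
        unfold cauchyProfile
        rw [div_le_div_iff₀ (by positivity) (by positivity)]
        have := pow_le_pow_left₀ (by positivity) hX 2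
        have e : (w ^ 3 * (3 / 50)) ^ 2 = 9 / 2500 * w ^ 6 := by ring
        nlinarith [pow_pos hw0 6]
      have : 0 ≤ 24000 / w * (cauchyProfile (3 * w * (4 * k + goldenAlpha * k₁) - x) *
          cauchyProfile ((2 * k₁ - k) / w)) := by positivity
      have := mul_le_mul_of_nonneg_left hsmall hb
      linarith
  refine (sum_le_sum fun k hk => sum_le_sum (hterm k hk)).trans ?_
  simp only [sum_add_distrib, ← mul_sum, ← sum_mul, sum_binProb]
  have hL : ∑ k ∈ range K, ∑ k₁ ∈ range (k + 1),
      cauchyProfile (3 * w * (4 * k + goldenAlpha * k₁) - x) *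
        cauchyProfile ((2 * k₁ - k) / w) ≤ C := by
    rw [sum_sigma']
    refine le_trans (le_of_eq ?_) (hlat w hw x
      (((range K).sigma fun k => range (k + 1)).image fun p => ((p.1 : ℤ), (p.2 : ℤ))))
    rw [sum_image]
    · simp
    · rintro ⟨a, b⟩ _ ⟨a', b'⟩ _ h
      simp only [Prod.mk.injEq, Nat.cast_inj] at h
      obtain ⟨rfl, rfl⟩ := h
      rfl
  have h1 : 24000 / w * ∑ k ∈ range K, ∑ k₁ ∈ range (k + 1),
      cauchyProfile (3 * w * (4 * k + goldenAlpha * k₁) - x) *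
        cauchyProfile ((2 * k₁ - k) / w) ≤ 24000 / w * C := by gcongr
  have h2 : 1 * ∑ k ∈ range K, 300 / w ^ 6 ≤ 6300 / w := by
    rw [one_mul, sum_const, card_range, nsmul_eq_mul]
    calc (K : ℝ) * (300 / w ^ 6) ≤ 21 * w ^ 2 * (300 / w ^ 6) := by gcongr
      _ = 6300 / w ^ 4 := by field_simp; norm_num
      _ ≤ 6300 / w := by
        gcongr
        exact le_self_pow₀ hw (by norm_num)
  refine (add_le_add h1 h2).trans (le_of_eq ?_)
  ring

lemma exists_return_le : ∃ C > 0, ∃ W : ℝ, 1 ≤ W ∧ ∀ (c : ℕ) (w : ℝ), W ≤ w → w ^ 4 = c →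
    ∀ m : ℕ, 2 / 5 * w ^ 6 ≤ m → (m : ℝ) ≤ 80 * w ^ 6 →
      (tcP (4 * c) ^ m) (Sum.inl ()) (Sum.inl ()) ≤ C / w ^ 4 := by
  obtain ⟨D, hD, hren⟩ := exists_sum_renewal_le
  obtain ⟨C, hC, hcnt⟩ := exists_sum_excursion_counts_le
  refine ⟨1200 * (D * 8401 * 4) * C + 168, by positivity, 42, by norm_num, ?_⟩
  intro c w hw hwc m hm1 hm2
  have hw0 : 0 < w := by linarith
  have hw1 : 1 ≤ w := by linarith
  have hcR : (2 : ℝ) ≤ c := by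
    rw [← hwc]; calc (2 : ℝ) ≤ w := by linarith
      _ ≤ w ^ 4 := le_self_pow₀ hw1 (by norm_num)
  have hc : 2 ≤ c := by exact_mod_cast hcR
  set K : ℕ := m / (4 * c) + 1 with hKdef
  have hmK : m < 4 * c * K := Nat.lt_mul_div_succ m (by omega)
  have hK : (K : ℝ) ≤ 21 * w ^ 2 := by
    have h1 : ((m / (4 * c) : ℕ) : ℝ) ≤ (m : ℝ) / (4 * w ^ 4) := by
      rw [hwc]; exact_mod_cast Nat.cast_div_le (α := ℝ) (m := m) (n := 4 * c)
    have h2 : (m : ℝ) / (4 * w ^ 4) ≤ 20 * w ^ 2 := by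
      rw [div_le_iff₀ (by positivity)]; linarith [(by ring : 20 * w ^ 2 * (4 * w ^ 4) = 80 * w ^ 6)]
    have h3 : 1 ≤ w ^ 2 := one_le_pow₀ hw1
    rw [hKdef]; push_cast; linarith
  have hbin : ∀ j : ℕ, binProb m j ≤ 1200 / w ^ 3 * cauchyProfile ((j - m / 2) / w ^ 3) := by
    intro j
    have := binProb_le_cauchyProfile (N := m) (u := 2 * w ^ 3) (a := 1 / 10) (b := 5)
      (by positivity) (by norm_num) (by norm_num) (by norm_num)
      (by linarith [(by ring : (2 * w ^ 3) ^ 2 = 4 * w ^ 6)])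
      (by linarith [(by ring : (5 * (2 * w ^ 3)) ^ 2 = 100 * w ^ 6), pow_pos hw0 6]) j
    refine this.trans (le_of_eq ?_)
    congr 1
    · field_simp; norm_num
    · congr 1; field_simp
  set A : ℝ := 1200 / w ^ 3 * (D * 8401 * 4) with hA
  have hA0 : 0 < A := by positivity
  have hpair : ∀ k ∈ range K, ∀ k₁ ∈ range (k + 1),
      ∑ j ∈ range (m + 1), binProb m j *
        (excursion c 0 ^ k₁ * excursion c 1 ^ (k - k₁) * renewalSource c).coeff j ≤
      A * cauchyProfile (3 * w * (4 * k + goldenAlpha * k₁) - m / 2 / w ^ 3) +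
        2 * (1 / 2) ^ c := by
    intro k hk k₁ hk₁
    have hkK : (k : ℝ) ≤ 21 * w ^ 2 :=
      le_trans (by exact_mod_cast (mem_range.1 hk).le) hK
    obtain ⟨μ, hμ, hconc⟩ := isConcentrated_excursion_pow hc (Nat.lt_succ_iff.1 (mem_range.1 hk₁))
    have h1 := hren c _ μ _ _ hconc (w ^ 3) (one_le_pow₀ hw1) m (m / 2) (1200 / w ^ 3)
      (by positivity) hbin
    have hV : 400 * (c : ℝ) * k / (w ^ 3) ^ 2 ≤ 8400 := by
      rw [← hwc, div_le_iff₀ (by positivity)]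
      calc 400 * w ^ 4 * k ≤ 400 * w ^ 4 * (21 * w ^ 2) := by gcongr
        _ = 8400 * (w ^ 3) ^ 2 := by ring
    have hcp : cauchyProfile ((μ - m / 2) / w ^ 3) ≤
        4 * cauchyProfile (3 * w * (4 * k + goldenAlpha * k₁) - m / 2 / w ^ 3) := by
      apply cauchyProfile_le_of_abs_le
      have e : (μ - m / 2) / w ^ 3 - (3 * w * (4 * k + goldenAlpha * k₁) - m / 2 / w ^ 3) =
          (μ - 3 * c * (4 * k + goldenAlpha * k₁)) / w ^ 3 := by
        rw [← hwc]; field_simp; ring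
      rw [e, abs_div, abs_of_pos (by positivity : 0 < w ^ 3), div_le_one (by positivity)]
      calc _ ≤ 2 * (k : ℝ) := hμ
        _ ≤ 42 * w ^ 2 := by linarith
        _ ≤ w * w ^ 2 := by gcongr
        _ = w ^ 3 := by ring
    refine h1.trans (add_le_add_left ?_ _)
    have := (cauchyProfile_pos ((μ - m / 2) / w ^ 3)).le
    calc _ ≤ 1200 / w ^ 3 * (D * (1 + 8400) *
          (4 * cauchyProfile (3 * w * (4 * k + goldenAlpha * k₁) - m / 2 / w ^ 3))) := by gcongr
      _ = _ := by rw [hA]; ring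
  have hx : w ^ 3 / 5 ≤ m / 2 / w ^ 3 := by
    rw [le_div_iff₀ (by positivity)]
    linarith [(by ring : w ^ 3 / 5 * w ^ 3 = w ^ 6 / 5)]
  have hcK := hcnt w hw1 _ hx K hK
  have hexpand : (tcP (4 * c) ^ m) (Sum.inl ()) (Sum.inl ()) ≤
      ∑ k ∈ range K, ∑ k₁ ∈ range (k + 1), binProb k k₁ * ∑ j ∈ range (m + 1), binProb m j *
        (excursion c 0 ^ k₁ * excursion c 1 ^ (k - k₁) * renewalSource c).coeff j := by
    rw [tcP_pow_eq_sum]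
    calc _ ≤ ∑ j ∈ range (m + 1), binProb m j *
          ∑ k ∈ range K, (meanExcursion c ^ k * renewalSource c).coeff j :=
          sum_le_sum fun j hj => mul_le_mul_of_nonneg_left
            (redReturn_le_sum (by omega) ((Nat.lt_succ_iff.1 (mem_range.1 hj)).trans_lt hmK))
            (binProb_nonneg m j)
      _ = ∑ k ∈ range K, ∑ j ∈ range (m + 1), binProb m j *
          (meanExcursion c ^ k * renewalSource c).coeff j := by
          simp only [mul_sum]; exact sum_comm
      _ = _ := by
          refine sum_congr rfl fun k _ => ?_
          simp only [meanExcursion_pow, sum_mul, smul_mul_assoc, map_sum,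
            PowerSeries.coeff_smul, smul_eq_mul, mul_sum]
          rw [sum_comm]
          exact sum_congr rfl fun k₁ _ => sum_congr rfl fun j _ => by ring
  have hhalf : (K : ℝ) * (2 * (1 / 2) ^ c) ≤ 168 / w ^ 4 := by
    have h1 := half_pow_le_inv_sq (by omega : 1 ≤ c)
    rw [← hwc] at h1
    calc (K : ℝ) * (2 * (1 / 2) ^ c) ≤ 21 * w ^ 2 * (2 * (4 / (w ^ 4) ^ 2)) := by gcongr
      _ = 168 / w ^ 6 := by field_simp; norm_num
      _ ≤ 168 / w ^ 4 := by
        gcongr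
        norm_num
  refine hexpand.trans ?_
  calc _ ≤ ∑ k ∈ range K, ∑ k₁ ∈ range (k + 1), binProb k k₁ *
        (A * cauchyProfile (3 * w * (4 * k + goldenAlpha * k₁) - m / 2 / w ^ 3) +
          2 * (1 / 2) ^ c) :=
        sum_le_sum fun k hk => sum_le_sum fun k₁ hk₁ =>
          mul_le_mul_of_nonneg_left (hpair k hk k₁ hk₁) (binProb_nonneg k k₁)
    _ = A * ∑ k ∈ range K, ∑ k₁ ∈ range (k + 1), binProb k k₁ *
          cauchyProfile (3 * w * (4 * k + goldenAlpha * k₁) - m / 2 / w ^ 3) +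
        K * (2 * (1 / 2) ^ c) := by
        simp only [mul_add, sum_add_distrib, ← sum_mul, sum_binProb, mul_left_comm _ A, ← mul_sum]
        simp
    _ ≤ A * (C / w) + 168 / w ^ 4 := by gcongr
    _ = _ := by rw [hA]; field_simp

lemma exp_neg_le_inv_sq {y : ℝ} (hy : 0 < y) : Real.exp (-y) ≤ 2 / y ^ 2 := by
  have h : y ^ 2 / 2 ≤ Real.exp y := by
    have := Real.quadratic_le_exp_of_nonneg hy.le; linarith
  rw [Real.exp_neg, ← one_div, div_le_div_iff₀ (Real.exp_pos y) (by positivity)]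
  linarith

/-- There are positive constants `c, C` such that for all sufficiently large
`n` divisible by `4`, the two-cycle chain with golden-ratio laziness satisfies
`c/n ≤ P^t(x,y) ≤ C/n` for all states `x, y` and every integer `t` with
`n^{3/2}/10 ≤ t ≤ 10·n^{3/2}`. -/
theorem twoCycle_transition_prob_all_states :
    ∃ c C : ℝ, 0 < c ∧ 0 < C ∧
      ∃ N : ℕ, ∀ n : ℕ, N ≤ n → 4 ∣ n →
        ∀ (x y : TwoCycleState n) (t : ℕ),
          (n : ℝ) ^ ((3 : ℝ) / 2) / 10 ≤ (t : ℝ) →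
          (t : ℝ) ≤ 10 * (n : ℝ) ^ ((3 : ℝ) / 2) →
          c / (n : ℝ) ≤ (tcP n ^ t) x y ∧ (tcP n ^ t) x y ≤ C / (n : ℝ) := by
  obtain ⟨δ, hδ, W₁, hW₁, hlow⟩ := exists_le_return
  obtain ⟨C, hC, W₂, hW₂, hupp⟩ := exists_return_le
  -- mixing over `s` steps leaves a defect `B / w ^ 4`
  set B : ℝ := 4 * 1440 ^ 2 with hB
  refine ⟨4 * (δ / 16), 4 * (3 * C + 4 * B), by positivity, by positivity,
    ⌈4 * max (max W₁ W₂) 10000 ^ 4⌉₊, ?_⟩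
  rintro n hn ⟨c, rfl⟩ x y t ht1 ht2
  set w : ℝ := √(√(c : ℝ)) with hw
  have hw0 : 0 ≤ w := Real.sqrt_nonneg _
  have hwc : w ^ 4 = c := by
    rw [hw, show 4 = 2 * 2 from rfl, pow_mul, Real.sq_sqrt (Real.sqrt_nonneg _),
      Real.sq_sqrt (Nat.cast_nonneg c)]
  have hwW : max (max W₁ W₂) 10000 ≤ w := by
    have h1 := (Nat.ceil_le.1 hn)
    push_cast at h1
    refine le_of_pow_le_pow_left₀ (n := 4) (by norm_num) hw0 ?_
    rw [hwc]; linarith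
  rw [max_le_iff, max_le_iff] at hwW
  obtain ⟨⟨hw1, hw2⟩, hw3⟩ := hwW
  have hwpos : 0 < w := by linarith
  have hpow : ((4 * c : ℕ) : ℝ) ^ ((3 : ℝ) / 2) = 8 * w ^ 6 := by
    have e : ((4 * c : ℕ) : ℝ) = (2 * w ^ 2) ^ (2 : ℝ) := by
      rw [Real.rpow_two]; push_cast; rw [← hwc]; ring
    rw [e, ← Real.rpow_mul (by positivity), show (2 : ℝ) * (3 / 2) = (3 : ℕ) by norm_num,
      Real.rpow_natCast]
    ring
  rw [hpow] at ht1 ht2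
  have hw6 : 10000 ≤ w ^ 6 := hw3.trans (le_self_pow₀ (by linarith) (by norm_num))
  set M : ℕ := ⌈2 / 5 * w ^ 6⌉₊ with hM
  set s : ℕ := ⌊w ^ 6 / 10⌋₊ with hs
  have hM1 : 2 / 5 * w ^ 6 ≤ M := Nat.le_ceil _
  have hM2 : (M : ℝ) < 2 / 5 * w ^ 6 + 1 := Nat.ceil_lt_add_one (by positivity)
  have hs1 : (s : ℝ) ≤ w ^ 6 / 10 := Nat.floor_le (by positivity)
  have hs2 : w ^ 6 / 10 < s + 1 := Nat.lt_floor_add_one _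
  have hMs : M + 2 * s ≤ t := by
    have : (M + 2 * s : ℝ) ≤ t := by linarith
    exact_mod_cast this
  have hc1 : (10000 : ℝ) ≤ c := by
    rw [← hwc]; exact hw3.trans (le_self_pow₀ (by linarith) (by norm_num))
  have hn2 : 2 ≤ 4 * c := by
    have : 1 ≤ c := by exact_mod_cast (by linarith : (1 : ℝ) ≤ c)
    omega
  have hT : 2 * (1 - 1 / (18 * ((4 * c : ℕ) : ℝ))) ^ s ≤ B / w ^ 4 := by
    push_cast
    rw [← hwc]
    have h1 : 1 - 1 / (18 * (4 * w ^ 4)) ≤ Real.exp (-(1 / (18 * (4 * w ^ 4)))) :=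
      Real.one_sub_le_exp_neg _
    have h0 : 0 ≤ 1 - 1 / (18 * (4 * w ^ 4)) := by
      rw [sub_nonneg, div_le_one (by positivity), hwc]; linarith
    have hy : w ^ 2 / 1440 ≤ s * (1 / (18 * (4 * w ^ 4))) := by
      rw [mul_one_div, div_le_div_iff₀ (by norm_num) (by positivity)]
      linarith [(by ring : w ^ 2 * (18 * (4 * w ^ 4)) = 72 * w ^ 6)]
    calc 2 * (1 - 1 / (18 * (4 * w ^ 4))) ^ s
        ≤ 2 * Real.exp (-(1 / (18 * (4 * w ^ 4)))) ^ s := by gcongr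
      _ = 2 * Real.exp (-(s * (1 / (18 * (4 * w ^ 4))))) := by
          rw [← Real.exp_nat_mul, mul_neg]
      _ ≤ 2 * Real.exp (-(w ^ 2 / 1440)) := by gcongr
      _ ≤ 2 * (2 / (w ^ 2 / 1440) ^ 2) := by gcongr; exact exp_neg_le_inv_sq (by positivity)
      _ = B / w ^ 4 := by rw [hB]; field_simp; norm_num
  have hT' : B / w ^ 4 ≤ 1 / 2 := by
    rw [div_le_div_iff₀ (by positivity) (by norm_num), hB]
    have : (10000 : ℝ) ^ 4 ≤ w ^ 4 := by gcongr
    linarith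
  obtain ⟨h1, h2⟩ := tcP_pow_bounds_of_return hn2 (lo := δ / w ^ 4) (hi := C / w ^ 4)
    (by positivity) (M := M) (m := t) (fun r hr1 hr2 => by
      have a : 2 / 5 * w ^ 6 ≤ r := hM1.trans (by exact_mod_cast hr1)
      have b : (r : ℝ) ≤ 80 * w ^ 6 :=
        le_trans (by exact_mod_cast hr2 : (r : ℝ) ≤ t) (by linarith)
      exact ⟨hlow c w hw1 hwc r a b, hupp c w hw2 hwc r a b⟩) hMs hT hT' x y
  push_cast
  rw [← hwc]
  refine ⟨le_trans (le_of_eq ?_) h1, h2.trans (le_of_eq ?_)⟩ <;> field_simp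
end

section
/- Let P be a stochastic matrix on a finite state space V with a stationary distribution π satisfying π(y) > 0 for all y. Define d∞(r) = max_{x,y} |P^r(x,y)/π(y) − 1| and d¹(r) = max_x ‖P^r(x,·) − π‖_TV. Then for all nonnegative integers s and t, d∞(s+t) ≤ 2·d¹(s)·d∞(t). -/
open Finset

/-- Powers of a matrix with unit row sums have unit row sums. -/
lemma sum_pow_row_eq_one {V : Type*} [Fintype V] [DecidableEq V] {P : Matrix V V ℝ}
    (hP1 : ∀ x, ∑ y, P x y = 1) (n : ℕ) (x : V) : ∑ y, (P ^ n) x y = 1 := by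
  have h : ∀ n : ℕ, (P ^ n).mulVec 1 = 1 := by
    intro n
    induction n with
    | zero => simp
    | succ k ih =>
      have hP : P.mulVec 1 = 1 := by
        ext x
        simp [Matrix.mulVec, dotProduct, hP1]
      rw [pow_succ, ← Matrix.mulVec_mulVec, hP, ih]
  simpa [Matrix.mulVec, dotProduct] using congrFun (h n) x

/-- A vector that is stationary for a matrix is stationary for its powers. -/
lemma sum_mul_pow_eq_of_stationary {V : Type*} [Fintype V] [DecidableEq V]
    {P : Matrix V V ℝ} {π : V → ℝ} (hπstat : ∀ y, ∑ x, π x * P x y = π y) (n : ℕ) (y : V) :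
    ∑ x, π x * (P ^ n) x y = π y := by
  have h : ∀ n : ℕ, Matrix.vecMul π (P ^ n) = π := by
    intro n
    induction n with
    | zero => simp
    | succ k ih =>
      have hP : Matrix.vecMul π P = π := funext hπstat
      rw [pow_succ, ← Matrix.vecMul_vecMul, ih, hP]
  exact congrFun (h n) y

/-- The relative density of `P ^ (s + t)`, centred at `1`, is the centred measure of `P ^ s`
integrated against the centred relative density of `P ^ t`. -/
lemma pow_add_div_sub_one_eq_sum {V : Type*} [Fintype V] [DecidableEq V]
    {P : Matrix V V ℝ} {π : V → ℝ} (hP1 : ∀ x, ∑ y, P x y = 1) (hπ1 : ∑ y, π y = 1)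
    (hπstat : ∀ y, ∑ x, π x * P x y = π y) (s t : ℕ) (x : V) {y : V} (hy : π y ≠ 0) :
    (P ^ (s + t)) x y / π y - 1 =
      ∑ z, ((P ^ s) x z - π z) * ((P ^ t) z y / π y - 1) := by
  have hexpand : ∀ z, ((P ^ s) x z - π z) * ((P ^ t) z y / π y - 1) =
      (P ^ s) x z * (P ^ t) z y / π y - π z * (P ^ t) z y / π y - (P ^ s) x z + π z :=
    fun z => by ring
  simp only [hexpand, Finset.sum_add_distrib, Finset.sum_sub_distrib, ← Finset.sum_div]
  rw [sum_mul_pow_eq_of_stationary hπstat, sum_pow_row_eq_one hP1, hπ1, div_self hy, pow_add,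
    Matrix.mul_apply]
  ring

/-- Let `P` be a stochastic matrix on a finite state space `V` with a
stationary distribution `π` satisfying `π(y) > 0` for all `y`. With
`d∞(r) = max_{x,y} |P^r(x,y)/π(y) − 1|` and `d¹(r) = max_x ‖P^r(x,·) − π‖_TV`, for all
nonnegative integers `s, t` we have `d∞(s+t) ≤ 2·d¹(s)·d∞(t)`. -/
theorem dinf_le_two_dTV_mul_dinf
    (V : Type) [Fintype V] [DecidableEq V] [Nonempty V]
    (P : Matrix V V ℝ) (π : V → ℝ)
    (hP0 : ∀ x y, 0 ≤ P x y) (hP1 : ∀ x, ∑ y, P x y = 1)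
    (hπpos : ∀ y, 0 < π y) (hπ1 : ∑ y, π y = 1)
    (hπstat : ∀ y, ∑ x, π x * P x y = π y) :
    ∀ s t : ℕ,
      (⨆ x, ⨆ y, |(P ^ (s + t)) x y / π y - 1|) ≤
        2 * (⨆ x, (1 / 2) * ∑ y, |(P ^ s) x y - π y|) *
          (⨆ x, ⨆ y, |(P ^ t) x y / π y - 1|) := by
  intro s t
  set D := ⨆ x, ⨆ y, |(P ^ t) x y / π y - 1|
  set d := ⨆ x, (1 / 2) * ∑ y, |(P ^ s) x y - π y|
  have hDle : ∀ z y, |(P ^ t) z y / π y - 1| ≤ D := fun z y =>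
    (le_ciSup (f := fun y => |(P ^ t) z y / π y - 1|) (Set.finite_range _).bddAbove y).trans
      (le_ciSup (f := fun z => ⨆ y, |(P ^ t) z y / π y - 1|) (Set.finite_range _).bddAbove z)
  have hdle : ∀ x, (1 / 2) * ∑ y, |(P ^ s) x y - π y| ≤ d := fun x =>
    le_ciSup (f := fun x => (1 / 2) * ∑ y, |(P ^ s) x y - π y|) (Set.finite_range _).bddAbove x
  refine ciSup_le fun x => ciSup_le fun y => ?_
  have hD0 : 0 ≤ D := (abs_nonneg _).trans (hDle x y)
  rw [pow_add_div_sub_one_eq_sum hP1 hπ1 hπstat s t x (hπpos y).ne']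
  calc |∑ z, ((P ^ s) x z - π z) * ((P ^ t) z y / π y - 1)|
      ≤ ∑ z, |((P ^ s) x z - π z) * ((P ^ t) z y / π y - 1)| := Finset.abs_sum_le_sum_abs _ _
    _ ≤ ∑ z, |(P ^ s) x z - π z| * D := by
        gcongr with z
        rw [abs_mul]
        exact mul_le_mul_of_nonneg_left (hDle z y) (abs_nonneg _)
    _ = (∑ z, |(P ^ s) x z - π z|) * D := (Finset.sum_mul _ _ _).symm
    _ ≤ 2 * d * D := by
        refine mul_le_mul_of_nonneg_right ?_ hD0
        linarith [hdle x]
end
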